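/- Case 18 of Theorem 1.2: the hypergeometric group Γ(f,g) generated by the companion matrices A and B of f(x) = x^5 - x^4 + x - 1 and g(x) = x^5 + 3x^4 + 5x^3 + 5x^2 + 3x + 1 is an arithmetic subgroup of the integral orthogonal group O_Q(ℤ): Γ(f,g) is contained in O_Q(ℤ) (in particular Aᵀ·Q·A = Q and Bᵀ·Q·B = Q), and Γ(f,g) has finite index in O_Q(ℤ). -/

import Mathlib

open Matrix

/-- The companion matrix `A` of `f(x) = x^5 - x^4 + x - 1`. -/
def matA : Matrix (Fin 5) (Fin 5) ℤ :=
  !![(0 : ℤ), 0, 0, 0, 1; 1, 0, 0, 0, -1; 0, 1, 0, 0, 0; 0, 0, 1, 0, 0; 0, 0, 0, 1, 1]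

/-- The companion matrix `B` of `g(x) = x^5 + 3*x^4 + 5*x^3 + 5*x^2 + 3*x + 1`. -/
def matB : Matrix (Fin 5) (Fin 5) ℤ :=
  !![(0 : ℤ), 0, 0, 0, -1; 1, 0, 0, 0, -3; 0, 1, 0, 0, -5; 0, 0, 1, 0, -5; 0, 0, 0, 1, -3]

/-- The symmetric integer matrix `Q` of the quadratic form preserved by `Γ(f,g)`. -/
def matQ : Matrix (Fin 5) (Fin 5) ℤ :=
  !![(73 : ℤ), -53, 1, 55, -71; -53, 73, -53, 1, 55; 1, -53, 73, -53, 1; 55, 1, -53, 73, -53; -71, 55, 1, -53, 73]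

/-- The integral orthogonal group `O_Q(ℤ)` of a matrix `Q`, as the subgroup of `GL₅(ℤ)`
consisting of all `M` with `Mᵀ * Q * M = Q`. -/
def orthogonalSubgroup (Q : Matrix (Fin 5) (Fin 5) ℤ) : Subgroup (GL (Fin 5) ℤ) where
  carrier := { M : GL (Fin 5) ℤ |
      (M : Matrix (Fin 5) (Fin 5) ℤ)ᵀ * Q * (M : Matrix (Fin 5) (Fin 5) ℤ) = Q }
  one_mem' := by simp
  mul_mem' := by
    intro a b ha hb
    simp only [Set.mem_setOf_eq, Units.val_mul, transpose_mul] at ha hb ⊢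
    calc ((b : Matrix (Fin 5) (Fin 5) ℤ)ᵀ * (a : Matrix (Fin 5) (Fin 5) ℤ)ᵀ) * Q *
          ((a : Matrix (Fin 5) (Fin 5) ℤ) * (b : Matrix (Fin 5) (Fin 5) ℤ))
        = (b : Matrix (Fin 5) (Fin 5) ℤ)ᵀ *
            ((a : Matrix (Fin 5) (Fin 5) ℤ)ᵀ * Q * (a : Matrix (Fin 5) (Fin 5) ℤ)) *
            (b : Matrix (Fin 5) (Fin 5) ℤ) := by
          simp only [mul_assoc]
      _ = Q := by rw [ha, hb]
  inv_mem' := by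
    intro a ha
    simp only [Set.mem_setOf_eq] at ha ⊢
    calc ((a⁻¹ : GL (Fin 5) ℤ) : Matrix (Fin 5) (Fin 5) ℤ)ᵀ * Q *
          ((a⁻¹ : GL (Fin 5) ℤ) : Matrix (Fin 5) (Fin 5) ℤ)
        = ((a⁻¹ : GL (Fin 5) ℤ) : Matrix (Fin 5) (Fin 5) ℤ)ᵀ *
            ((a : Matrix (Fin 5) (Fin 5) ℤ)ᵀ * Q * (a : Matrix (Fin 5) (Fin 5) ℤ)) *
            ((a⁻¹ : GL (Fin 5) ℤ) : Matrix (Fin 5) (Fin 5) ℤ) := by rw [ha]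
      _ = ((a : Matrix (Fin 5) (Fin 5) ℤ) *
            ((a⁻¹ : GL (Fin 5) ℤ) : Matrix (Fin 5) (Fin 5) ℤ))ᵀ * Q *
          ((a : Matrix (Fin 5) (Fin 5) ℤ) *
            ((a⁻¹ : GL (Fin 5) ℤ) : Matrix (Fin 5) (Fin 5) ℤ)) := by
          simp only [transpose_mul, mul_assoc]
      _ = Q := by rw [Units.mul_inv]; simp

set_option maxRecDepth 100000

namespace HG

/-- 5×5 integer matrices in a form convenient for kernel computation. -/
structure M5 where
  (a00 a01 a02 a03 a04 : ℤ)
  (a10 a11 a12 a13 a14 : ℤ)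
  (a20 a21 a22 a23 a24 : ℤ)
  (a30 a31 a32 a33 a34 : ℤ)
  (a40 a41 a42 a43 a44 : ℤ)
namespace M5

def mul (x y : M5) : M5 :=
  ⟨x.a00 * y.a00 + x.a01 * y.a10 + x.a02 * y.a20 + x.a03 * y.a30 + x.a04 * y.a40, x.a00 * y.a01 + x.a01 * y.a11 + x.a02 * y.a21 + x.a03 * y.a31 + x.a04 * y.a41, x.a00 * y.a02 + x.a01 * y.a12 + x.a02 * y.a22 + x.a03 * y.a32 + x.a04 * y.a42, x.a00 * y.a03 + x.a01 * y.a13 + x.a02 * y.a23 + x.a03 * y.a33 + x.a04 * y.a43, x.a00 * y.a04 + x.a01 * y.a14 + x.a02 * y.a24 + x.a03 * y.a34 + x.a04 * y.a44,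
   x.a10 * y.a00 + x.a11 * y.a10 + x.a12 * y.a20 + x.a13 * y.a30 + x.a14 * y.a40, x.a10 * y.a01 + x.a11 * y.a11 + x.a12 * y.a21 + x.a13 * y.a31 + x.a14 * y.a41, x.a10 * y.a02 + x.a11 * y.a12 + x.a12 * y.a22 + x.a13 * y.a32 + x.a14 * y.a42, x.a10 * y.a03 + x.a11 * y.a13 + x.a12 * y.a23 + x.a13 * y.a33 + x.a14 * y.a43, x.a10 * y.a04 + x.a11 * y.a14 + x.a12 * y.a24 + x.a13 * y.a34 + x.a14 * y.a44,
   x.a20 * y.a00 + x.a21 * y.a10 + x.a22 * y.a20 + x.a23 * y.a30 + x.a24 * y.a40, x.a20 * y.a01 + x.a21 * y.a11 + x.a22 * y.a21 + x.a23 * y.a31 + x.a24 * y.a41, x.a20 * y.a02 + x.a21 * y.a12 + x.a22 * y.a22 + x.a23 * y.a32 + x.a24 * y.a42, x.a20 * y.a03 + x.a21 * y.a13 + x.a22 * y.a23 + x.a23 * y.a33 + x.a24 * y.a43, x.a20 * y.a04 + x.a21 * y.a14 + x.a22 * y.a24 + x.a23 * y.a34 + x.a24 * y.a44,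
   x.a30 * y.a00 + x.a31 * y.a10 + x.a32 * y.a20 + x.a33 * y.a30 + x.a34 * y.a40, x.a30 * y.a01 + x.a31 * y.a11 + x.a32 * y.a21 + x.a33 * y.a31 + x.a34 * y.a41, x.a30 * y.a02 + x.a31 * y.a12 + x.a32 * y.a22 + x.a33 * y.a32 + x.a34 * y.a42, x.a30 * y.a03 + x.a31 * y.a13 + x.a32 * y.a23 + x.a33 * y.a33 + x.a34 * y.a43, x.a30 * y.a04 + x.a31 * y.a14 + x.a32 * y.a24 + x.a33 * y.a34 + x.a34 * y.a44,
   x.a40 * y.a00 + x.a41 * y.a10 + x.a42 * y.a20 + x.a43 * y.a30 + x.a44 * y.a40, x.a40 * y.a01 + x.a41 * y.a11 + x.a42 * y.a21 + x.a43 * y.a31 + x.a44 * y.a41, x.a40 * y.a02 + x.a41 * y.a12 + x.a42 * y.a22 + x.a43 * y.a32 + x.a44 * y.a42, x.a40 * y.a03 + x.a41 * y.a13 + x.a42 * y.a23 + x.a43 * y.a33 + x.a44 * y.a43, x.a40 * y.a04 + x.a41 * y.a14 + x.a42 * y.a24 + x.a43 * y.a34 + x.a44 * y.a44⟩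

def eqb (x y : M5) : Bool :=
  decide (x.a00 = y.a00) && decide (x.a01 = y.a01) && decide (x.a02 = y.a02) && decide (x.a03 = y.a03) && decide (x.a04 = y.a04) &&
  decide (x.a10 = y.a10) && decide (x.a11 = y.a11) && decide (x.a12 = y.a12) && decide (x.a13 = y.a13) && decide (x.a14 = y.a14) &&
  decide (x.a20 = y.a20) && decide (x.a21 = y.a21) && decide (x.a22 = y.a22) && decide (x.a23 = y.a23) && decide (x.a24 = y.a24) &&
  decide (x.a30 = y.a30) && decide (x.a31 = y.a31) && decide (x.a32 = y.a32) && decide (x.a33 = y.a33) && decide (x.a34 = y.a34) &&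
  decide (x.a40 = y.a40) && decide (x.a41 = y.a41) && decide (x.a42 = y.a42) && decide (x.a43 = y.a43) && decide (x.a44 = y.a44)

def toMat (x : M5) : Matrix (Fin 5) (Fin 5) ℤ :=
  !![x.a00, x.a01, x.a02, x.a03, x.a04;
    x.a10, x.a11, x.a12, x.a13, x.a14;
    x.a20, x.a21, x.a22, x.a23, x.a24;
    x.a30, x.a31, x.a32, x.a33, x.a34;
    x.a40, x.a41, x.a42, x.a43, x.a44]

def one : M5 := ⟨1,0,0,0,0,0,1,0,0,0,0,0,1,0,0,0,0,0,1,0,0,0,0,0,1⟩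

theorem eq_of_eqb {x y : M5} (h : eqb x y = true) : x = y := by
  cases x; cases y
  simp only [eqb, Bool.and_eq_true, decide_eq_true_eq] at h
  simp only [M5.mk.injEq]
  tauto

theorem toMat_mul (x y : M5) : (mul x y).toMat = x.toMat * y.toMat := by
  ext i j
  fin_cases i <;> fin_cases j <;>
    simp [toMat, mul, Matrix.mul_apply, Fin.sum_univ_succ] <;> ring

theorem toMat_one : one.toMat = 1 := by
  ext i j
  fin_cases i <;> fin_cases j <;> simp [toMat, one]

def mem (x : M5) (l : List M5) : Bool := l.any (eqb x)

theorem mem_of_mem {x : M5} {l : List M5} (h : mem x l = true) : x ∈ l := by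
  simp only [mem, List.any_eq_true] at h
  obtain ⟨y, hy, he⟩ := h
  rw [eq_of_eqb he]; exact hy

/-- The product of the entries of `l` with the given indices. -/
def word (l : List M5) : List ℕ → M5
  | [] => one
  | [k] => l.getD k one
  | k :: ks => mul (l.getD k one) (word l ks)

end M5

open M5

def zipAll {α β : Type} (p : α → β → Bool) : List α → List β → Bool
  | [], _ => true
  | _ :: _, [] => false
  | a :: as, b :: bs => p a b && zipAll p as bs

theorem zipAll_spec {α β : Type} (p : α → β → Bool) :
    ∀ (l : List α) (m : List β), zipAll p l m = true → ∀ a ∈ l, ∃ b, p a b = true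
  | [], _, _, a, ha => by simp at ha
  | _ :: _, [], h, _, _ => by simp [zipAll] at h
  | c :: as, b :: bs, h, a, ha => by
      simp only [zipAll, Bool.and_eq_true] at h
      rcases List.mem_cons.1 ha with rfl | ha
      · exact ⟨b, h.1⟩
      · exact zipAll_spec p as bs h.2 a ha

/-- Check that each matrix in `st` is a word in the previous ones. -/
def stepsOk : List M5 → List (M5 × List ℕ) → Bool
  | _, [] => true
  | l, (g, w) :: st => eqb (word l w) g && stepsOk (l ++ [g]) st

/-- `A`, `A⁻¹`, `B`, `B⁻¹` in the hyperbolic basis. -/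
def gens0 : List M5 := [
  ⟨0,0,0,1,0,-1,1,1,-1,-4,1,0,0,-1,0,0,1,0,1,0,0,0,0,-1,-1⟩,
  ⟨1,0,1,0,0,-1,0,0,1,0,-1,1,1,-1,-4,1,0,0,0,0,-1,0,0,0,-1⟩,
  ⟨0,0,0,1,0,-3,-1,1,-5,-4,0,-1,0,-3,0,-1,0,0,-1,0,0,0,0,-1,-1⟩,
  ⟨-1,0,0,-1,0,-3,0,-1,0,0,-5,1,-1,-3,-4,1,0,0,0,0,-1,0,0,0,-1⟩]

/-- Further elements of the group, each a word in the previous ones. -/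
def steps : List (M5 × List ℕ) := [
  (⟨0,1,0,1,0,0,0,1,0,0,0,-1,0,0,0,-1,2,1,0,-4,0,-1,0,0,1⟩, [0, 0]),
  (⟨0,1,2,-1,-4,0,0,-1,0,0,0,1,0,0,0,1,0,1,0,0,0,0,-1,0,1⟩, [1, 1]),
  (⟨1,0,0,0,0,-4,1,-2,-2,0,-2,0,0,-1,0,-2,0,-1,0,0,0,0,0,0,1⟩, [2, 1]),
  (⟨1,0,0,0,0,-4,1,-2,-2,0,-2,0,0,-1,0,-2,0,-1,0,0,0,0,0,0,1⟩, [0, 3]),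
  (⟨0,-1,0,-2,0,-1,0,0,-2,0,-2,-2,1,-4,0,0,0,0,1,0,0,0,0,0,1⟩, [3, 0]),
  (⟨0,-1,0,-2,0,-1,0,0,-2,0,-2,-2,1,-4,0,0,0,0,1,0,0,0,0,0,1⟩, [1, 2]),
  (⟨-1,2,2,0,-4,0,-1,0,0,0,0,0,-1,0,0,0,2,2,-1,-4,0,-1,-1,0,1⟩, [5, 5]),
  (⟨-1,2,2,0,-4,0,-1,0,0,0,0,0,-1,0,0,0,2,2,-1,-4,0,-1,-1,0,1⟩, [4, 4]),
  (⟨-5,1,-3,-1,4,0,0,-1,0,0,-8,1,-5,0,8,1,0,1,0,0,2,0,1,0,-1⟩, [1, 3, 3, 3, 1]),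
  (⟨0,1,0,1,0,0,-5,1,-8,8,0,-1,0,0,0,-1,-3,1,-5,4,0,1,0,2,-1⟩, [0, 2, 2, 2, 0]),
  (⟨-1,1,-1,1,4,2,0,0,1,0,-2,1,-2,3,8,-1,0,0,-1,0,0,0,0,-1,-1⟩, [12, 6]),
  (⟨0,1,0,1,0,2,-1,-1,-2,0,1,1,-1,3,-4,0,-1,0,-2,0,0,1,0,2,-1⟩, [7, 13]),
  (⟨-1,0,0,-1,0,3,0,-1,0,0,1,1,-1,3,-4,1,0,0,0,0,-1,0,0,0,-1⟩, [15, 8]),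
  (⟨0,0,0,1,0,3,-1,1,1,-4,0,-1,0,3,0,-1,0,0,-1,0,0,0,0,-1,-1⟩, [9, 14]),
  (⟨-2,0,-1,0,0,3,-1,1,1,-4,-2,-1,-1,2,0,1,0,1,0,0,2,0,1,0,-1⟩, [17, 6]),
  (⟨-1,0,0,-1,0,3,-2,1,-2,8,1,0,0,2,0,1,-1,1,-1,4,-1,0,0,0,-1⟩, [7, 16]),
  (⟨1,-1,1,-1,4,0,1,0,0,0,0,-1,2,-1,4,0,1,-1,2,-4,0,1,-1,1,-3⟩, [18, 16]),
  (⟨1,-1,1,-1,4,0,1,0,0,0,0,-1,2,-1,4,0,1,-1,2,-4,0,1,-1,1,-3⟩, [17, 19]),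
  (⟨2,-1,1,0,-4,-1,2,-1,0,4,0,0,1,0,0,-1,1,-1,1,4,1,-1,1,0,-3⟩, [15, 17]),
  (⟨2,-1,1,0,-4,-1,2,-1,0,4,0,0,1,0,0,-1,1,-1,1,4,1,-1,1,0,-3⟩, [16, 14]),
  (⟨1,0,0,0,0,0,1,-6,0,0,0,0,1,0,0,6,0,0,1,0,0,0,0,0,1⟩, [19, 2, 6]),
  (⟨1,0,0,0,0,0,1,6,0,0,0,0,1,0,0,-6,0,0,1,0,0,0,0,0,1⟩, [7, 3, 18]),
  (⟨1,0,0,-6,0,0,1,0,0,0,0,6,1,0,0,0,0,0,1,0,0,0,0,0,1⟩, [8, 2, 15]),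
  (⟨1,0,0,6,0,0,1,0,0,0,0,-6,1,0,0,0,0,0,1,0,0,0,0,0,1⟩, [14, 3, 9]),
  (⟨0,1,0,1,0,0,1,1,-8,8,0,-1,0,0,0,-1,3,1,1,4,0,1,0,2,-1⟩, [19, 2, 15]),
  (⟨1,1,3,-1,4,0,0,-1,0,0,-8,1,1,0,8,1,0,1,0,0,2,0,1,0,-1⟩, [14, 3, 18]),
  (⟨-3,4,-4,-1,8,0,0,-1,0,0,0,1,-3,0,0,1,0,4,0,0,0,0,2,0,1⟩, [20, 5, 22]),
  (⟨0,4,0,1,0,0,-3,1,0,0,0,-1,0,0,0,-1,-4,4,-3,8,0,2,0,0,1⟩, [23, 4, 21]),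
  (⟨-3,2,-3,-2,0,2,0,0,1,0,-1,2,-4,0,4,-4,-1,2,-3,-4,-1,-1,2,-1,-3⟩, [20, 1, 3]),
  (⟨0,2,-1,2,-4,2,-3,-4,-1,-4,1,-2,-3,0,-4,0,-3,2,-4,8,0,0,-1,1,-3⟩, [2, 0, 21]),
  (⟨-4,2,-3,0,8,0,-3,-2,1,-4,-1,-4,-3,2,-4,2,-1,2,0,-4,1,-1,0,0,-3⟩, [8, 5, 22]),
  (⟨-3,2,-1,-4,-4,0,-4,2,-1,4,1,0,0,2,0,-2,-3,2,-3,0,-1,2,-1,-1,-3⟩, [23, 4, 9]),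
  (⟨-6,2,-4,-1,8,0,0,-1,0,0,-9,2,-6,0,12,2,-1,2,0,-4,3,-1,2,0,-5⟩, [20, 12]),
  (⟨0,2,-1,2,-4,0,-6,2,-9,12,0,-1,0,0,0,-1,-4,2,-6,8,0,2,-1,3,-5⟩, [13, 21]),
  (⟨1,-4,-2,2,-8,0,1,0,0,0,0,2,2,-1,4,0,-2,-1,2,-4,0,-2,-1,1,-3⟩, [30, 4, 20]),
  (⟨1,-4,-2,2,-8,0,1,0,0,0,0,2,2,-1,4,0,-2,-1,2,-4,0,-2,-1,1,-3⟩, [21, 5, 31]),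
  (⟨2,-1,-2,0,-4,-1,2,2,0,4,0,0,1,0,0,2,-2,-4,1,-8,1,-1,-2,0,-3⟩, [28, 38, 29]),
  (⟨2,-1,-2,0,-4,-1,2,2,0,4,0,0,1,0,0,2,-2,-4,1,-8,1,-1,-2,0,-3⟩, [28, 39, 29]),
  (⟨0,-1,-1,2,-4,0,3,2,-9,12,0,-1,0,0,0,-1,-1,-1,3,-4,0,-1,-1,3,-5⟩, [28, 38]),
  (⟨3,-1,-1,-1,-4,0,0,-1,0,0,-9,2,3,0,12,2,-1,-1,0,-4,3,-1,-1,0,-5⟩, [39, 29]),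
  (⟨-5,6,-2,1,-16,3,-2,1,-2,8,3,-3,1,1,8,-1,2,0,0,-4,-3,3,-1,1,-9⟩, [38, 19]),
  (⟨-2,6,2,-3,12,3,-5,-1,3,-12,-2,1,0,1,4,1,-2,0,1,-4,2,-4,-1,2,-9⟩, [18, 39]),
  (⟨0,0,2,-1,-4,1,1,-3,3,8,-2,1,-2,3,8,1,-2,6,-5,-16,1,-1,3,-3,-9⟩, [40, 14]),
  (⟨1,0,-2,1,-4,1,0,1,-2,4,3,-1,-5,3,-12,-3,2,6,-2,12,2,-1,-4,2,-9⟩, [15, 41]),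
  (⟨1,0,-1,2,4,0,1,0,0,0,0,0,1,-2,-4,0,1,0,1,0,0,0,0,-1,-1⟩, [10, 45, 35, 5, 22, 44, 10, 0]),
  (⟨1,0,1,0,0,0,1,0,0,0,0,2,1,-2,-4,0,-1,0,1,0,0,1,0,-1,-1⟩, [1, 11, 45, 23, 4, 34, 44, 11]),
  (⟨0,-1,0,1,0,0,2,1,0,0,0,-1,0,0,0,-1,-2,-1,2,0,0,0,0,0,1⟩, [4, 49, 49]),
  (⟨2,-1,-2,-1,0,0,0,-1,0,0,0,1,2,0,0,1,0,-1,0,0,0,0,0,0,1⟩, [48, 48, 5]),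
  (⟨1,-1,-1,1,-4,0,1,0,0,0,0,-1,1,0,0,0,1,0,1,0,0,1,0,0,1⟩, [51, 40, 50, 38]),
  (⟨1,-1,1,-1,4,0,1,0,0,0,0,1,1,0,0,0,-1,0,1,0,0,-1,0,0,1⟩, [39, 51, 41, 50]),
  (⟨-1,2,-2,-1,0,0,0,-1,0,0,0,1,-1,0,0,1,0,2,0,0,0,0,0,0,1⟩, [53, 5]),
  (⟨0,2,0,1,0,0,-1,1,0,0,0,-1,0,0,0,-1,-2,2,-1,0,0,0,0,0,1⟩, [4, 52]),
  (⟨1,0,-1,0,0,0,1,1,0,0,0,0,1,0,0,-1,1,-1,1,4,0,0,-1,0,1⟩, [55, 5]),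
  (⟨1,0,1,0,0,0,1,-1,0,0,0,0,1,0,0,1,-1,-1,1,-4,0,0,1,0,1⟩, [4, 54]),
  (⟨1,0,0,0,0,-2,1,0,-5,4,1,0,1,-2,4,0,0,0,1,0,1,0,0,1,-1⟩, [42, 51, 53, 20, 50]),
  (⟨1,0,0,0,0,-2,1,0,1,4,-5,0,1,-2,4,0,0,0,1,0,1,0,0,1,-1⟩, [51, 21, 52, 50, 43]),
  (⟨0,-1,0,1,0,-1,0,0,1,0,1,1,1,-1,0,0,0,0,1,0,0,0,0,0,1⟩, [57, 38, 56]),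
  (⟨0,-1,0,1,0,-1,0,0,1,0,1,1,1,-1,0,0,0,0,1,0,0,0,0,0,1⟩, [57, 39, 56]),
  (⟨1,0,-6,0,0,0,1,0,0,0,0,0,1,0,0,0,6,0,1,0,0,0,0,0,1⟩, [55, 55, 55]),
  (⟨1,0,6,0,0,0,1,0,0,0,0,0,1,0,0,0,-6,0,1,0,0,0,0,0,1⟩, [54, 54, 54]),
  (⟨1,0,0,0,0,0,1,0,0,0,0,0,2,-1,4,0,0,-1,2,-4,0,0,-1,1,-3⟩, [53, 20]),
  (⟨1,0,0,0,0,0,1,0,0,0,0,0,2,-1,4,0,0,-1,2,-4,0,0,-1,1,-3⟩, [21, 52]),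
  (⟨-2,2,-2,-1,4,0,0,-1,2,4,0,1,-2,4,8,1,0,2,-4,-8,0,0,1,-3,-5⟩, [40, 53, 14]),
  (⟨0,2,0,1,0,0,-2,1,0,0,2,-1,-4,4,-12,-1,-2,2,-2,4,1,1,-2,2,-5⟩, [15, 52, 41]),
  (⟨0,-2,0,1,0,0,3,1,0,0,0,-1,0,0,0,-1,2,-2,3,8,0,2,0,0,1⟩, [18, 51, 14]),
  (⟨3,-2,2,-1,8,0,0,-1,0,0,0,1,3,0,0,1,0,-2,0,0,0,0,2,0,1⟩, [15, 50, 19])]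

/-- All the group elements used. -/
def gensl : List M5 := [
  ⟨0,0,0,1,0,-1,1,1,-1,-4,1,0,0,-1,0,0,1,0,1,0,0,0,0,-1,-1⟩,
  ⟨1,0,1,0,0,-1,0,0,1,0,-1,1,1,-1,-4,1,0,0,0,0,-1,0,0,0,-1⟩,
  ⟨0,0,0,1,0,-3,-1,1,-5,-4,0,-1,0,-3,0,-1,0,0,-1,0,0,0,0,-1,-1⟩,
  ⟨-1,0,0,-1,0,-3,0,-1,0,0,-5,1,-1,-3,-4,1,0,0,0,0,-1,0,0,0,-1⟩,
  ⟨0,1,0,1,0,0,0,1,0,0,0,-1,0,0,0,-1,2,1,0,-4,0,-1,0,0,1⟩,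
  ⟨0,1,2,-1,-4,0,0,-1,0,0,0,1,0,0,0,1,0,1,0,0,0,0,-1,0,1⟩,
  ⟨1,0,0,0,0,-4,1,-2,-2,0,-2,0,0,-1,0,-2,0,-1,0,0,0,0,0,0,1⟩,
  ⟨1,0,0,0,0,-4,1,-2,-2,0,-2,0,0,-1,0,-2,0,-1,0,0,0,0,0,0,1⟩,
  ⟨0,-1,0,-2,0,-1,0,0,-2,0,-2,-2,1,-4,0,0,0,0,1,0,0,0,0,0,1⟩,
  ⟨0,-1,0,-2,0,-1,0,0,-2,0,-2,-2,1,-4,0,0,0,0,1,0,0,0,0,0,1⟩,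
  ⟨-1,2,2,0,-4,0,-1,0,0,0,0,0,-1,0,0,0,2,2,-1,-4,0,-1,-1,0,1⟩,
  ⟨-1,2,2,0,-4,0,-1,0,0,0,0,0,-1,0,0,0,2,2,-1,-4,0,-1,-1,0,1⟩,
  ⟨-5,1,-3,-1,4,0,0,-1,0,0,-8,1,-5,0,8,1,0,1,0,0,2,0,1,0,-1⟩,
  ⟨0,1,0,1,0,0,-5,1,-8,8,0,-1,0,0,0,-1,-3,1,-5,4,0,1,0,2,-1⟩,
  ⟨-1,1,-1,1,4,2,0,0,1,0,-2,1,-2,3,8,-1,0,0,-1,0,0,0,0,-1,-1⟩,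
  ⟨0,1,0,1,0,2,-1,-1,-2,0,1,1,-1,3,-4,0,-1,0,-2,0,0,1,0,2,-1⟩,
  ⟨-1,0,0,-1,0,3,0,-1,0,0,1,1,-1,3,-4,1,0,0,0,0,-1,0,0,0,-1⟩,
  ⟨0,0,0,1,0,3,-1,1,1,-4,0,-1,0,3,0,-1,0,0,-1,0,0,0,0,-1,-1⟩,
  ⟨-2,0,-1,0,0,3,-1,1,1,-4,-2,-1,-1,2,0,1,0,1,0,0,2,0,1,0,-1⟩,
  ⟨-1,0,0,-1,0,3,-2,1,-2,8,1,0,0,2,0,1,-1,1,-1,4,-1,0,0,0,-1⟩,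
  ⟨1,-1,1,-1,4,0,1,0,0,0,0,-1,2,-1,4,0,1,-1,2,-4,0,1,-1,1,-3⟩,
  ⟨1,-1,1,-1,4,0,1,0,0,0,0,-1,2,-1,4,0,1,-1,2,-4,0,1,-1,1,-3⟩,
  ⟨2,-1,1,0,-4,-1,2,-1,0,4,0,0,1,0,0,-1,1,-1,1,4,1,-1,1,0,-3⟩,
  ⟨2,-1,1,0,-4,-1,2,-1,0,4,0,0,1,0,0,-1,1,-1,1,4,1,-1,1,0,-3⟩,
  ⟨1,0,0,0,0,0,1,-6,0,0,0,0,1,0,0,6,0,0,1,0,0,0,0,0,1⟩,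
  ⟨1,0,0,0,0,0,1,6,0,0,0,0,1,0,0,-6,0,0,1,0,0,0,0,0,1⟩,
  ⟨1,0,0,-6,0,0,1,0,0,0,0,6,1,0,0,0,0,0,1,0,0,0,0,0,1⟩,
  ⟨1,0,0,6,0,0,1,0,0,0,0,-6,1,0,0,0,0,0,1,0,0,0,0,0,1⟩,
  ⟨0,1,0,1,0,0,1,1,-8,8,0,-1,0,0,0,-1,3,1,1,4,0,1,0,2,-1⟩,
  ⟨1,1,3,-1,4,0,0,-1,0,0,-8,1,1,0,8,1,0,1,0,0,2,0,1,0,-1⟩,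
  ⟨-3,4,-4,-1,8,0,0,-1,0,0,0,1,-3,0,0,1,0,4,0,0,0,0,2,0,1⟩,
  ⟨0,4,0,1,0,0,-3,1,0,0,0,-1,0,0,0,-1,-4,4,-3,8,0,2,0,0,1⟩,
  ⟨-3,2,-3,-2,0,2,0,0,1,0,-1,2,-4,0,4,-4,-1,2,-3,-4,-1,-1,2,-1,-3⟩,
  ⟨0,2,-1,2,-4,2,-3,-4,-1,-4,1,-2,-3,0,-4,0,-3,2,-4,8,0,0,-1,1,-3⟩,
  ⟨-4,2,-3,0,8,0,-3,-2,1,-4,-1,-4,-3,2,-4,2,-1,2,0,-4,1,-1,0,0,-3⟩,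
  ⟨-3,2,-1,-4,-4,0,-4,2,-1,4,1,0,0,2,0,-2,-3,2,-3,0,-1,2,-1,-1,-3⟩,
  ⟨-6,2,-4,-1,8,0,0,-1,0,0,-9,2,-6,0,12,2,-1,2,0,-4,3,-1,2,0,-5⟩,
  ⟨0,2,-1,2,-4,0,-6,2,-9,12,0,-1,0,0,0,-1,-4,2,-6,8,0,2,-1,3,-5⟩,
  ⟨1,-4,-2,2,-8,0,1,0,0,0,0,2,2,-1,4,0,-2,-1,2,-4,0,-2,-1,1,-3⟩,
  ⟨1,-4,-2,2,-8,0,1,0,0,0,0,2,2,-1,4,0,-2,-1,2,-4,0,-2,-1,1,-3⟩,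
  ⟨2,-1,-2,0,-4,-1,2,2,0,4,0,0,1,0,0,2,-2,-4,1,-8,1,-1,-2,0,-3⟩,
  ⟨2,-1,-2,0,-4,-1,2,2,0,4,0,0,1,0,0,2,-2,-4,1,-8,1,-1,-2,0,-3⟩,
  ⟨0,-1,-1,2,-4,0,3,2,-9,12,0,-1,0,0,0,-1,-1,-1,3,-4,0,-1,-1,3,-5⟩,
  ⟨3,-1,-1,-1,-4,0,0,-1,0,0,-9,2,3,0,12,2,-1,-1,0,-4,3,-1,-1,0,-5⟩,
  ⟨-5,6,-2,1,-16,3,-2,1,-2,8,3,-3,1,1,8,-1,2,0,0,-4,-3,3,-1,1,-9⟩,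
  ⟨-2,6,2,-3,12,3,-5,-1,3,-12,-2,1,0,1,4,1,-2,0,1,-4,2,-4,-1,2,-9⟩,
  ⟨0,0,2,-1,-4,1,1,-3,3,8,-2,1,-2,3,8,1,-2,6,-5,-16,1,-1,3,-3,-9⟩,
  ⟨1,0,-2,1,-4,1,0,1,-2,4,3,-1,-5,3,-12,-3,2,6,-2,12,2,-1,-4,2,-9⟩,
  ⟨1,0,-1,2,4,0,1,0,0,0,0,0,1,-2,-4,0,1,0,1,0,0,0,0,-1,-1⟩,
  ⟨1,0,1,0,0,0,1,0,0,0,0,2,1,-2,-4,0,-1,0,1,0,0,1,0,-1,-1⟩,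
  ⟨0,-1,0,1,0,0,2,1,0,0,0,-1,0,0,0,-1,-2,-1,2,0,0,0,0,0,1⟩,
  ⟨2,-1,-2,-1,0,0,0,-1,0,0,0,1,2,0,0,1,0,-1,0,0,0,0,0,0,1⟩,
  ⟨1,-1,-1,1,-4,0,1,0,0,0,0,-1,1,0,0,0,1,0,1,0,0,1,0,0,1⟩,
  ⟨1,-1,1,-1,4,0,1,0,0,0,0,1,1,0,0,0,-1,0,1,0,0,-1,0,0,1⟩,
  ⟨-1,2,-2,-1,0,0,0,-1,0,0,0,1,-1,0,0,1,0,2,0,0,0,0,0,0,1⟩,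
  ⟨0,2,0,1,0,0,-1,1,0,0,0,-1,0,0,0,-1,-2,2,-1,0,0,0,0,0,1⟩,
  ⟨1,0,-1,0,0,0,1,1,0,0,0,0,1,0,0,-1,1,-1,1,4,0,0,-1,0,1⟩,
  ⟨1,0,1,0,0,0,1,-1,0,0,0,0,1,0,0,1,-1,-1,1,-4,0,0,1,0,1⟩,
  ⟨1,0,0,0,0,-2,1,0,-5,4,1,0,1,-2,4,0,0,0,1,0,1,0,0,1,-1⟩,
  ⟨1,0,0,0,0,-2,1,0,1,4,-5,0,1,-2,4,0,0,0,1,0,1,0,0,1,-1⟩,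
  ⟨0,-1,0,1,0,-1,0,0,1,0,1,1,1,-1,0,0,0,0,1,0,0,0,0,0,1⟩,
  ⟨0,-1,0,1,0,-1,0,0,1,0,1,1,1,-1,0,0,0,0,1,0,0,0,0,0,1⟩,
  ⟨1,0,-6,0,0,0,1,0,0,0,0,0,1,0,0,0,6,0,1,0,0,0,0,0,1⟩,
  ⟨1,0,6,0,0,0,1,0,0,0,0,0,1,0,0,0,-6,0,1,0,0,0,0,0,1⟩,
  ⟨1,0,0,0,0,0,1,0,0,0,0,0,2,-1,4,0,0,-1,2,-4,0,0,-1,1,-3⟩,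
  ⟨1,0,0,0,0,0,1,0,0,0,0,0,2,-1,4,0,0,-1,2,-4,0,0,-1,1,-3⟩,
  ⟨-2,2,-2,-1,4,0,0,-1,2,4,0,1,-2,4,8,1,0,2,-4,-8,0,0,1,-3,-5⟩,
  ⟨0,2,0,1,0,0,-2,1,0,0,2,-1,-4,4,-12,-1,-2,2,-2,4,1,1,-2,2,-5⟩,
  ⟨0,-2,0,1,0,0,3,1,0,0,0,-1,0,0,0,-1,2,-2,3,8,0,2,0,0,1⟩,
  ⟨3,-2,2,-1,8,0,0,-1,0,0,0,1,3,0,0,1,0,-2,0,0,0,0,2,0,1⟩]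

/-- The root unipotents. -/
def Ul : List M5 := [
  ⟨1,0,0,-1,0,0,1,0,0,0,0,1,1,0,0,0,0,0,1,0,0,0,0,0,1⟩,
  ⟨1,-2,0,0,4,0,1,0,0,0,0,0,1,0,0,0,0,0,1,0,0,-1,0,0,1⟩,
  ⟨1,0,0,1,0,0,1,0,0,0,0,-1,1,0,0,0,0,0,1,0,0,0,0,0,1⟩,
  ⟨1,-2,0,0,-4,0,1,0,0,0,0,0,1,0,0,0,0,0,1,0,0,1,0,0,1⟩,
  ⟨1,0,0,0,0,0,1,0,-1,0,1,0,1,0,0,0,0,0,1,0,0,0,0,0,1⟩,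
  ⟨1,0,0,0,0,-2,1,0,0,4,0,0,1,0,0,0,0,0,1,0,-1,0,0,0,1⟩,
  ⟨1,0,0,0,0,0,1,0,1,0,-1,0,1,0,0,0,0,0,1,0,0,0,0,0,1⟩,
  ⟨1,0,0,0,0,-2,1,0,0,-4,0,0,1,0,0,0,0,0,1,0,1,0,0,0,1⟩,
  ⟨1,0,0,0,0,0,1,0,0,0,0,0,1,-2,4,0,0,0,1,0,0,0,0,-1,1⟩,
  ⟨1,0,0,0,0,0,1,0,0,0,0,0,1,-2,-4,0,0,0,1,0,0,0,0,1,1⟩,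
  ⟨1,0,1,0,0,0,1,0,0,0,0,0,1,0,0,0,-1,0,1,0,0,0,0,0,1⟩,
  ⟨1,0,0,0,0,0,1,0,0,0,0,0,1,0,0,0,0,-2,1,4,0,0,-1,0,1⟩,
  ⟨1,0,-1,0,0,0,1,0,0,0,0,0,1,0,0,0,1,0,1,0,0,0,0,0,1⟩,
  ⟨1,0,0,0,0,0,1,0,0,0,0,0,1,0,0,0,0,-2,1,-4,0,0,1,0,1⟩,
  ⟨1,0,0,0,0,0,1,1,0,0,0,0,1,0,0,-1,0,0,1,0,0,0,0,0,1⟩,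
  ⟨1,0,0,0,0,0,1,-1,0,0,0,0,1,0,0,1,0,0,1,0,0,0,0,0,1⟩]

/-- The finite group of signed permutations. -/
def Fl : List M5 := [
  ⟨1,0,0,0,0,0,1,0,0,0,0,0,1,0,0,0,0,0,1,0,0,0,0,0,1⟩,
  ⟨0,1,0,0,0,1,0,0,0,0,0,0,1,0,0,0,0,0,1,0,0,0,0,0,1⟩,
  ⟨0,0,1,0,0,0,0,0,1,0,1,0,0,0,0,0,1,0,0,0,0,0,0,0,1⟩,
  ⟨1,0,0,0,0,0,1,0,0,0,0,0,1,0,0,0,0,0,1,0,0,0,0,0,-1⟩,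
  ⟨-1,0,0,0,0,0,-1,0,0,0,0,0,1,0,0,0,0,0,1,0,0,0,0,0,1⟩,
  ⟨0,0,0,1,0,0,0,1,0,0,1,0,0,0,0,0,1,0,0,0,0,0,0,0,1⟩,
  ⟨0,1,0,0,0,1,0,0,0,0,0,0,1,0,0,0,0,0,1,0,0,0,0,0,-1⟩,
  ⟨0,-1,0,0,0,-1,0,0,0,0,0,0,1,0,0,0,0,0,1,0,0,0,0,0,1⟩,
  ⟨0,0,1,0,0,0,0,0,1,0,0,1,0,0,0,1,0,0,0,0,0,0,0,0,1⟩,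
  ⟨0,0,1,0,0,0,0,0,1,0,1,0,0,0,0,0,1,0,0,0,0,0,0,0,-1⟩,
  ⟨0,0,1,0,0,0,0,0,1,0,-1,0,0,0,0,0,-1,0,0,0,0,0,0,0,1⟩,
  ⟨-1,0,0,0,0,0,-1,0,0,0,0,0,1,0,0,0,0,0,1,0,0,0,0,0,-1⟩,
  ⟨0,0,-1,0,0,0,0,0,-1,0,1,0,0,0,0,0,1,0,0,0,0,0,0,0,1⟩,
  ⟨0,0,0,1,0,0,0,1,0,0,0,1,0,0,0,1,0,0,0,0,0,0,0,0,1⟩,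
  ⟨0,0,0,1,0,0,0,1,0,0,1,0,0,0,0,0,1,0,0,0,0,0,0,0,-1⟩,
  ⟨0,0,0,1,0,0,0,1,0,0,-1,0,0,0,0,0,-1,0,0,0,0,0,0,0,1⟩,
  ⟨0,-1,0,0,0,-1,0,0,0,0,0,0,1,0,0,0,0,0,1,0,0,0,0,0,-1⟩,
  ⟨0,0,0,-1,0,0,0,-1,0,0,1,0,0,0,0,0,1,0,0,0,0,0,0,0,1⟩,
  ⟨1,0,0,0,0,0,1,0,0,0,0,0,0,1,0,0,0,1,0,0,0,0,0,0,1⟩,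
  ⟨0,0,1,0,0,0,0,0,1,0,0,1,0,0,0,1,0,0,0,0,0,0,0,0,-1⟩,
  ⟨0,0,1,0,0,0,0,0,1,0,0,-1,0,0,0,-1,0,0,0,0,0,0,0,0,1⟩,
  ⟨0,0,1,0,0,0,0,0,1,0,-1,0,0,0,0,0,-1,0,0,0,0,0,0,0,-1⟩,
  ⟨1,0,0,0,0,0,1,0,0,0,0,0,-1,0,0,0,0,0,-1,0,0,0,0,0,1⟩,
  ⟨0,0,-1,0,0,0,0,0,-1,0,1,0,0,0,0,0,1,0,0,0,0,0,0,0,-1⟩,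
  ⟨0,0,-1,0,0,0,0,0,-1,0,0,1,0,0,0,1,0,0,0,0,0,0,0,0,1⟩,
  ⟨0,0,-1,0,0,0,0,0,-1,0,-1,0,0,0,0,0,-1,0,0,0,0,0,0,0,1⟩,
  ⟨0,1,0,0,0,1,0,0,0,0,0,0,0,1,0,0,0,1,0,0,0,0,0,0,1⟩,
  ⟨0,0,0,1,0,0,0,1,0,0,0,1,0,0,0,1,0,0,0,0,0,0,0,0,-1⟩,
  ⟨0,0,0,1,0,0,0,1,0,0,0,-1,0,0,0,-1,0,0,0,0,0,0,0,0,1⟩,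
  ⟨0,0,0,1,0,0,0,1,0,0,-1,0,0,0,0,0,-1,0,0,0,0,0,0,0,-1⟩,
  ⟨0,1,0,0,0,1,0,0,0,0,0,0,-1,0,0,0,0,0,-1,0,0,0,0,0,1⟩,
  ⟨0,0,0,-1,0,0,0,-1,0,0,1,0,0,0,0,0,1,0,0,0,0,0,0,0,-1⟩,
  ⟨0,0,0,-1,0,0,0,-1,0,0,0,1,0,0,0,1,0,0,0,0,0,0,0,0,1⟩,
  ⟨0,0,0,-1,0,0,0,-1,0,0,-1,0,0,0,0,0,-1,0,0,0,0,0,0,0,1⟩,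
  ⟨1,0,0,0,0,0,1,0,0,0,0,0,0,1,0,0,0,1,0,0,0,0,0,0,-1⟩,
  ⟨-1,0,0,0,0,0,-1,0,0,0,0,0,0,1,0,0,0,1,0,0,0,0,0,0,1⟩,
  ⟨0,0,1,0,0,0,0,0,1,0,0,-1,0,0,0,-1,0,0,0,0,0,0,0,0,-1⟩,
  ⟨1,0,0,0,0,0,1,0,0,0,0,0,0,-1,0,0,0,-1,0,0,0,0,0,0,1⟩,
  ⟨1,0,0,0,0,0,1,0,0,0,0,0,-1,0,0,0,0,0,-1,0,0,0,0,0,-1⟩,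
  ⟨-1,0,0,0,0,0,-1,0,0,0,0,0,-1,0,0,0,0,0,-1,0,0,0,0,0,1⟩,
  ⟨0,0,-1,0,0,0,0,0,-1,0,0,1,0,0,0,1,0,0,0,0,0,0,0,0,-1⟩,
  ⟨0,0,-1,0,0,0,0,0,-1,0,-1,0,0,0,0,0,-1,0,0,0,0,0,0,0,-1⟩,
  ⟨0,0,-1,0,0,0,0,0,-1,0,0,-1,0,0,0,-1,0,0,0,0,0,0,0,0,1⟩,
  ⟨0,1,0,0,0,1,0,0,0,0,0,0,0,1,0,0,0,1,0,0,0,0,0,0,-1⟩,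
  ⟨0,-1,0,0,0,-1,0,0,0,0,0,0,0,1,0,0,0,1,0,0,0,0,0,0,1⟩,
  ⟨0,0,0,1,0,0,0,1,0,0,0,-1,0,0,0,-1,0,0,0,0,0,0,0,0,-1⟩,
  ⟨0,1,0,0,0,1,0,0,0,0,0,0,0,-1,0,0,0,-1,0,0,0,0,0,0,1⟩,
  ⟨0,1,0,0,0,1,0,0,0,0,0,0,-1,0,0,0,0,0,-1,0,0,0,0,0,-1⟩,
  ⟨0,-1,0,0,0,-1,0,0,0,0,0,0,-1,0,0,0,0,0,-1,0,0,0,0,0,1⟩,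
  ⟨0,0,0,-1,0,0,0,-1,0,0,0,1,0,0,0,1,0,0,0,0,0,0,0,0,-1⟩,
  ⟨0,0,0,-1,0,0,0,-1,0,0,-1,0,0,0,0,0,-1,0,0,0,0,0,0,0,-1⟩,
  ⟨0,0,0,-1,0,0,0,-1,0,0,0,-1,0,0,0,-1,0,0,0,0,0,0,0,0,1⟩,
  ⟨-1,0,0,0,0,0,-1,0,0,0,0,0,0,1,0,0,0,1,0,0,0,0,0,0,-1⟩,
  ⟨1,0,0,0,0,0,1,0,0,0,0,0,0,-1,0,0,0,-1,0,0,0,0,0,0,-1⟩,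
  ⟨-1,0,0,0,0,0,-1,0,0,0,0,0,0,-1,0,0,0,-1,0,0,0,0,0,0,1⟩,
  ⟨-1,0,0,0,0,0,-1,0,0,0,0,0,-1,0,0,0,0,0,-1,0,0,0,0,0,-1⟩,
  ⟨0,0,-1,0,0,0,0,0,-1,0,0,-1,0,0,0,-1,0,0,0,0,0,0,0,0,-1⟩,
  ⟨0,-1,0,0,0,-1,0,0,0,0,0,0,0,1,0,0,0,1,0,0,0,0,0,0,-1⟩,
  ⟨0,1,0,0,0,1,0,0,0,0,0,0,0,-1,0,0,0,-1,0,0,0,0,0,0,-1⟩,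
  ⟨0,-1,0,0,0,-1,0,0,0,0,0,0,0,-1,0,0,0,-1,0,0,0,0,0,0,1⟩,
  ⟨0,-1,0,0,0,-1,0,0,0,0,0,0,-1,0,0,0,0,0,-1,0,0,0,0,0,-1⟩,
  ⟨0,0,0,-1,0,0,0,-1,0,0,0,-1,0,0,0,-1,0,0,0,0,0,0,0,0,-1⟩,
  ⟨-1,0,0,0,0,0,-1,0,0,0,0,0,0,-1,0,0,0,-1,0,0,0,0,0,0,-1⟩,
  ⟨0,-1,0,0,0,-1,0,0,0,0,0,0,0,-1,0,0,0,-1,0,0,0,0,0,0,-1⟩]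

/-- Double coset representatives. -/
def Sl : List M5 := [
  ⟨1,0,0,0,0,0,1,0,0,0,0,0,1,0,0,0,0,0,1,0,0,0,0,0,1⟩,
  ⟨1,0,0,-1,0,0,1,0,0,0,0,1,1,0,0,0,0,0,1,0,0,0,0,0,1⟩,
  ⟨0,0,0,1,0,0,1,1,0,0,0,-1,0,0,0,-1,0,0,1,0,0,0,0,0,1⟩,
  ⟨1,0,0,1,0,0,1,0,0,0,0,-1,1,0,0,0,0,0,1,0,0,0,0,0,1⟩,
  ⟨0,1,0,1,0,0,0,1,0,0,0,-1,0,0,0,-1,0,1,0,0,0,0,0,0,1⟩,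
  ⟨1,0,0,0,0,0,1,0,-1,0,1,0,1,0,0,0,0,0,1,0,0,0,0,0,1⟩,
  ⟨1,0,1,0,0,0,1,0,0,0,0,0,1,0,0,0,-1,0,1,0,0,0,0,0,-1⟩,
  ⟨0,-1,0,0,0,-1,0,0,1,0,0,1,1,0,0,0,0,0,1,0,0,0,0,0,1⟩,
  ⟨0,-1,0,0,0,-1,2,0,0,-4,0,0,1,0,0,0,0,0,1,0,0,-1,0,0,1⟩,
  ⟨1,0,0,0,0,0,1,0,0,0,0,0,1,-2,-4,0,0,0,1,0,0,0,0,1,1⟩,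
  ⟨1,0,0,0,0,0,1,1,0,0,0,0,1,0,0,-1,0,0,1,0,0,0,0,0,1⟩,
  ⟨1,0,0,-2,0,0,1,0,0,0,0,2,1,0,0,0,0,0,1,0,0,0,0,0,1⟩,
  ⟨0,1,0,1,0,0,1,1,0,0,0,-1,0,0,0,-1,1,1,1,0,0,0,0,0,1⟩,
  ⟨0,-1,0,-1,0,-1,0,0,-1,0,-1,-1,1,-1,0,0,0,0,1,0,0,0,0,0,1⟩,
  ⟨0,-1,0,-1,0,-1,2,0,0,4,-1,2,1,0,4,0,0,0,1,0,0,1,0,0,1⟩,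
  ⟨1,0,0,-1,0,0,1,0,1,0,-1,1,1,1,0,0,0,0,1,0,0,0,0,0,1⟩,
  ⟨1,-1,-1,-1,0,0,1,0,0,0,0,1,1,0,0,0,1,0,1,0,0,0,0,0,-1⟩,
  ⟨1,0,0,-1,0,0,1,0,0,0,0,1,1,-2,-4,0,0,0,1,0,0,0,0,1,1⟩,
  ⟨1,0,0,1,0,0,1,0,0,0,0,-1,1,-2,4,0,0,0,1,0,0,0,0,1,-1⟩,
  ⟨0,0,1,-2,4,1,0,0,1,0,-1,0,0,0,0,0,-1,1,-2,4,0,0,0,-1,1⟩,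
  ⟨1,-1,1,1,0,0,1,0,0,0,0,-1,1,0,0,0,-1,0,1,0,0,0,0,0,1⟩,
  ⟨0,1,1,-2,4,1,0,0,0,0,-1,0,0,1,0,0,0,1,-2,4,0,0,0,-1,1⟩,
  ⟨2,-1,0,0,4,-1,0,0,-1,0,2,-1,1,0,4,0,0,0,1,0,-1,0,0,0,-1⟩,
  ⟨0,-1,0,0,0,-1,-1,1,-1,0,0,-1,0,-1,0,0,1,-1,0,0,0,0,0,0,1⟩,
  ⟨0,1,0,0,0,1,-1,1,1,0,0,-1,0,1,0,0,-1,1,0,0,0,0,0,0,-1⟩,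
  ⟨0,-1,-1,0,0,0,1,0,-1,0,1,-1,1,-1,-4,0,1,0,0,0,0,1,0,0,1⟩,
  ⟨0,-1,0,0,0,-1,2,1,0,-4,0,0,1,0,0,0,1,0,1,0,0,-1,0,0,1⟩,
  ⟨0,0,0,-1,0,0,2,-1,0,0,0,1,0,0,0,1,0,0,2,0,0,0,0,0,1⟩,
  ⟨1,0,0,-2,0,0,1,0,0,0,0,2,1,-2,-4,0,0,0,1,0,0,0,0,1,1⟩,
  ⟨1,-1,1,-1,4,0,1,0,0,0,0,-1,1,-2,4,0,-1,0,1,0,0,0,0,1,-1⟩,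
  ⟨1,-1,1,-1,4,0,0,0,1,0,0,1,0,-1,0,1,-2,0,-1,4,0,-1,0,0,1⟩,
  ⟨0,-1,0,-1,0,-1,2,0,-1,4,-1,1,1,-1,4,0,0,0,1,0,0,1,0,0,1⟩]

/-- The coset table. -/
def certs : List (List (List ℕ × ℕ × ℕ)) := [
  [([], 1, 0), ([53, 51], 2, 0), ([], 3, 0), ([5], 4, 0), ([], 5, 0), ([4, 60, 1], 6, 0), ([], 7, 7), ([], 8, 7), ([49], 4, 49), ([], 9, 0), ([], 6, 3), ([56, 50], 3, 32), ([], 4, 32), ([4], 6, 49), ([], 10, 0), ([], 2, 32)],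
  [([], 11, 0), ([53], 4, 32), ([], 0, 0), ([5], 12, 0), ([], 13, 7), ([], 14, 7), ([], 15, 0), ([59, 14, 60, 16], 6, 28), ([49], 16, 0), ([], 17, 0), ([54], 4, 0), ([54, 51, 4], 11, 28), ([], 16, 3), ([54, 52], 16, 45), ([54, 51], 12, 28), ([], 10, 32)],
  [([50], 4, 32), ([57], 4, 0), ([], 0, 28), ([56, 50], 0, 0), ([60, 51], 0, 5), ([60, 52], 0, 7), ([60], 4, 33), ([16, 58, 6], 4, 7), ([0], 3, 16), ([42], 18, 37), ([50], 3, 0), ([], 19, 26), ([], 12, 0), ([10], 2, 39), ([50], 12, 0), ([], 3, 0)],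
  [([], 0, 0), ([53, 51], 0, 28), ([51], 6, 45), ([52], 6, 3), ([60, 51], 6, 14), ([60, 52], 6, 16), ([60], 0, 7), ([16, 58, 6], 0, 5), ([1], 2, 16), ([], 18, 3), ([], 20, 0), ([], 21, 26), ([51], 2, 0), ([10], 3, 39), ([], 2, 0), ([51], 20, 0)],
  [([], 12, 0), ([4], 0, 0), ([55], 6, 3), ([56], 2, 0), ([], 7, 35), ([64, 51, 28], 9, 14), ([55], 13, 33), ([48], 0, 45), ([68, 48, 55], 10, 55), ([60, 13], 22, 0), ([], 0, 28), ([53, 51], 12, 28), ([55], 1, 0), ([52], 1, 28), ([51], 2, 28), ([], 16, 45)],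
  [([], 13, 7), ([8, 58], 15, 16), ([60, 51], 6, 14), ([], 22, 16), ([60, 51], 23, 7), ([18, 60], 24, 0), ([], 0, 0), ([58], 9, 3), ([49], 7, 14), ([53], 25, 0), ([60, 51], 13, 59), ([17, 60, 58], 25, 30), ([], 6, 23), ([50, 60, 1], 7, 14), ([], 23, 59), ([60, 51], 0, 37)],
  [([54], 4, 3), ([5], 0, 45), ([], 20, 3), ([53], 3, 3), ([54], 24, 0), ([57, 50, 43], 8, 0), ([], 5, 21), ([50, 60, 1], 0, 0), ([36, 60, 35], 14, 8), ([49, 49, 67, 53], 1, 32), ([54], 10, 45), ([57], 10, 3), ([], 0, 3), ([64, 56], 20, 19), ([54], 16, 39), ([50], 3, 49)],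
  [([60], 15, 0), ([19], 25, 45), ([], 0, 7), ([0], 5, 21), ([60], 0, 0), ([48], 5, 19), ([], 15, 7), ([60, 19], 25, 14), ([67, 53], 13, 43), ([59], 8, 3), ([60], 4, 26), ([6, 59], 23, 3), ([], 24, 52), ([48, 2], 14, 26), ([60], 24, 43), ([], 4, 35)],
  [([19], 25, 45), ([13, 53, 26, 51], 6, 7), ([58], 9, 16), ([], 0, 7), ([58, 60], 9, 3), ([56, 22], 0, 0), ([58], 25, 19), ([42, 52, 51], 6, 0), ([60, 53, 55], 13, 35), ([58], 7, 3), ([42], 18, 32), ([22, 50, 27], 17, 32), ([], 26, 0), ([37, 40, 54, 2], 22, 49), ([56], 26, 0), ([58, 52], 18, 8)],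
  [([], 17, 0), ([20, 51, 24], 26, 28), ([], 18, 3), ([12, 48, 2, 2], 14, 8), ([53], 25, 0), ([17, 58, 2, 49], 24, 3), ([59], 8, 16), ([59], 5, 3), ([], 0, 0), ([12, 56, 25, 50], 4, 49), ([53], 17, 0), ([43, 57, 50], 4, 19), ([52], 18, 3), ([64], 0, 37), ([20], 25, 37), ([60, 43], 8, 53)],
  [([6, 55], 20, 30), ([53, 68, 4], 27, 0), ([], 1, 28), ([5, 51, 4], 16, 45), ([], 23, 59), ([18, 60], 16, 39), ([], 24, 43), ([], 26, 7), ([2, 0], 22, 55), ([58, 2, 49], 4, 55), ([54], 16, 55), ([56], 6, 3), ([55], 6, 49), ([4], 20, 32), ([], 27, 28), ([], 0, 0)],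
  [([51, 24, 54], 16, 49), ([53], 16, 3), ([], 1, 0), ([49, 67, 53], 1, 32), ([8], 1, 7), ([3, 67, 53, 8], 1, 33), ([6, 60, 6], 16, 50), ([9, 53], 16, 16), ([60, 16], 27, 47), ([], 28, 0), ([54], 12, 0), ([5, 22, 38], 21, 32), ([51, 24], 27, 39), ([49, 49, 22, 54, 52], 11, 30), ([8, 51, 24], 27, 30), ([54, 51], 12, 0)],
  [([50, 55], 1, 32), ([4], 1, 0), ([], 4, 0), ([56, 50], 4, 32), ([60], 4, 7), ([52, 56, 22], 4, 33), ([55, 8], 1, 33), ([48, 0], 1, 7), ([4, 48], 20, 3), ([37], 29, 37), ([], 2, 0), ([53, 51], 30, 35), ([55], 11, 0), ([10], 12, 39), ([50, 55], 11, 0), ([51], 2, 0)],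
  [([], 1, 7), ([58, 2, 49], 24, 5), ([8], 5, 0), ([], 31, 0), ([], 5, 7), ([8], 31, 7), ([8], 1, 0), ([49, 49, 67, 53], 24, 5), ([49], 15, 56), ([14], 26, 47), ([], 23, 8), ([54, 48], 7, 43), ([8, 54], 4, 12), ([54, 52, 60], 8, 35), ([54], 4, 42), ([8], 23, 10)],
  [([34, 37], 22, 7), ([], 1, 7), ([], 31, 0), ([0, 12, 24, 2, 60, 51], 6, 5), ([2], 31, 21), ([2, 55, 50, 66, 15], 6, 28), ([3, 49, 13], 22, 0), ([5, 48, 0], 1, 0), ([3, 49], 7, 26), ([2], 23, 52), ([2, 0], 22, 14), ([33, 17, 60, 19], 9, 5), ([34, 37], 29, 12), ([9, 5, 22, 60], 26, 30), ([3, 3, 67], 29, 5), ([6, 55, 40, 20], 22, 14)],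
  [([6, 60, 6], 16, 50), ([60, 19, 59], 26, 5), ([], 7, 7), ([48], 13, 50), ([], 1, 0), ([34, 37], 22, 0), ([2, 49], 24, 45), ([59, 8], 5, 16), ([67, 53], 23, 45), ([], 25, 10), ([], 16, 21), ([48, 3, 60], 25, 33), ([48, 3], 7, 37), ([67, 64], 23, 56), ([6, 48, 3], 1, 37), ([], 24, 23)],
  [([51, 24], 27, 55), ([52], 11, 3), ([], 4, 49), ([53, 55], 1, 49), ([], 15, 23), ([56, 49, 4], 10, 39), ([55], 23, 45), ([48, 58, 17], 26, 30), ([53, 51, 28], 17, 0), ([48], 1, 0), ([], 1, 3), ([49, 49, 4], 10, 49), ([55], 10, 55), ([55, 57], 27, 49), ([55, 50, 27], 11, 45), ([55], 6, 39)],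
  [([], 28, 0), ([26, 51, 22], 8, 28), ([], 9, 0), ([12, 60, 13], 22, 3), ([17], 26, 47), ([18], 24, 7), ([], 25, 10), ([9, 53, 51, 24], 23, 42), ([], 1, 0), ([12, 56, 50, 27], 16, 0), ([53], 28, 0), ([17, 56, 6, 50, 27], 16, 37), ([52], 9, 0), ([20], 1, 37), ([18], 26, 43), ([20], 25, 33)],
  [([], 9, 3), ([12, 55], 29, 3), ([53, 43], 8, 28), ([60, 58, 60], 28, 0), ([53, 59], 8, 5), ([58, 60], 28, 7), ([60], 9, 16), ([51, 54, 48, 33], 29, 63), ([29, 56], 2, 0), ([], 3, 3), ([53], 9, 3), ([64, 52], 3, 53), ([43], 8, 28), ([43], 2, 37), ([60, 43], 8, 5), ([60, 53], 9, 16)],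
  [([], 21, 0), ([39, 35, 51, 24], 27, 8), ([57], 30, 7), ([41, 32], 27, 42), ([53, 51], 30, 7), ([53, 14, 49], 27, 5), ([50], 21, 0), ([50, 62, 52, 50, 5], 27, 10), ([53, 57, 30, 63, 4, 60], 2, 37), ([], 2, 26), ([60, 53], 21, 7), ([40, 56], 2, 30), ([40], 30, 59), ([32, 23, 54, 8, 54], 2, 0), ([53], 30, 7), ([57, 50], 21, 0)],
  [([], 6, 3), ([53, 51], 6, 45), ([51, 54], 10, 39), ([5], 10, 28), ([54, 6], 10, 30), ([5, 49, 0], 10, 5), ([60, 51], 6, 16), ([57, 64], 6, 14), ([49, 5], 12, 3), ([], 29, 3), ([54], 27, 39), ([], 30, 5), ([], 3, 0), ([10], 20, 39), ([50], 3, 0), ([14, 49], 27, 30)],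
  [([51], 30, 8), ([39, 35], 11, 42), ([], 19, 0), ([41, 32, 50, 27], 11, 8), ([51], 19, 0), ([51, 63, 57, 51, 4], 11, 10), ([], 30, 8), ([38, 55, 52], 11, 5), ([52, 23, 50, 62, 56, 50], 3, 37), ([], 3, 26), ([60, 53], 30, 10), ([64, 52], 3, 30), ([52, 38], 19, 37), ([35, 21, 55, 6, 55], 3, 0), ([52, 51], 19, 0), ([53], 30, 8)],
  [([52], 29, 7), ([12, 35, 48, 58, 17], 8, 45), ([1, 3], 14, 19), ([12, 60, 13], 17, 3), ([36, 35], 14, 7), ([], 5, 16), ([8], 31, 16), ([12, 0, 2], 15, 0), ([3, 4, 14, 49], 4, 0), ([1, 3], 10, 55), ([64, 40], 29, 37), ([1, 3, 49, 0], 10, 52), ([52, 32, 49, 0], 14, 19), ([9, 54, 48, 6, 48, 3], 4, 37), ([32, 49, 6], 14, 37), ([1], 31, 42)],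
  [([], 5, 59), ([58, 20], 25, 16), ([6, 50, 27], 16, 50), ([18, 60], 15, 49), ([54], 16, 49), ([54, 48], 15, 49), ([50, 60, 8], 5, 0), ([54, 52, 60, 19], 25, 3), ([50, 60, 3], 24, 8), ([17, 60, 58], 17, 33), ([], 10, 59), ([58, 6], 7, 3), ([14, 60, 15], 13, 28), ([3], 14, 52), ([], 13, 5), ([14, 60, 15], 10, 37)],
  [([], 7, 52), ([19], 17, 7), ([6], 10, 47), ([2, 60, 51], 23, 5), ([6], 15, 50), ([48, 16, 59, 3], 9, 3), ([55], 6, 0), ([56, 49, 4], 5, 0), ([0, 2], 31, 3), ([48, 16, 58], 13, 8), ([6], 7, 55), ([59, 14, 60, 16], 13, 8), ([], 10, 43), ([2, 2], 31, 53), ([], 15, 21), ([6, 55], 6, 37)],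
  [([52, 17], 26, 47), ([], 15, 12), ([59], 8, 14), ([18, 56], 23, 52), ([60, 59, 19], 17, 32), ([17, 6, 58, 60], 15, 32), ([52], 9, 0), ([59, 22], 23, 16), ([52], 5, 0), ([59, 56, 22], 7, 23), ([59, 16], 9, 26), ([9, 53, 26, 60], 5, 26), ([], 17, 12), ([18], 7, 49), ([18], 8, 49), ([59], 26, 53)],
  [([19], 17, 43), ([13, 66, 0, 52, 8], 16, 30), ([57, 19], 25, 55), ([], 10, 7), ([58], 25, 53), ([22], 10, 0), ([15], 17, 55), ([16, 53, 6, 60, 6], 16, 39), ([15], 13, 47), ([7, 56, 50, 27], 15, 10), ([], 8, 0), ([25, 50, 20], 9, 32), ([37], 28, 49), ([60, 35], 14, 30), ([19], 28, 21), ([57], 8, 0)],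
  [([], 10, 32), ([56, 54], 16, 45), ([50, 27], 16, 55), ([5, 69, 52], 10, 0), ([6, 50, 27], 16, 47), ([2, 18, 48, 3], 10, 7), ([6], 10, 33), ([7, 56, 54], 16, 14), ([37], 28, 52), ([17, 60], 11, 47), ([50, 27], 11, 39), ([55, 10, 54], 27, 39), ([55], 20, 39), ([4, 20, 40], 19, 32), ([6, 55], 20, 30), ([6, 50, 27], 11, 30)],
  [([52, 36], 26, 45), ([60, 59], 18, 7), ([], 17, 0), ([52], 29, 3), ([8], 17, 7), ([8, 52], 29, 16), ([52, 17], 26, 14), ([9, 60, 59], 18, 0), ([], 11, 0), ([12, 56], 27, 55), ([36], 26, 45), ([12, 22], 27, 52), ([52], 17, 0), ([21, 53], 11, 37), ([8, 52], 17, 7), ([18], 26, 23)],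
  [([36, 60, 35], 14, 8), ([5, 57, 13], 18, 3), ([40, 64], 22, 37), ([53], 28, 3), ([53], 22, 7), ([50, 60, 53], 28, 16), ([36, 35], 14, 10), ([14, 49, 13], 18, 16), ([12, 57], 12, 0), ([], 20, 3), ([66, 2, 2], 14, 8), ([64], 20, 53), ([12, 60, 13], 22, 0), ([12, 22], 12, 37), ([20], 22, 59), ([66, 6, 35], 14, 10)],
  [([64, 56], 19, 0), ([21, 28, 59, 60, 62, 50], 20, 42), ([], 21, 5), ([], 20, 8), ([52], 21, 5), ([64], 20, 10), ([56], 19, 7), ([39, 31, 55, 6, 55, 51], 20, 5), ([51, 63, 22, 53], 12, 59), ([56, 50], 12, 35), ([52], 19, 7), ([60, 52], 12, 39), ([50], 21, 5), ([32, 54, 30, 53], 12, 7), ([52, 40], 21, 12), ([52, 38], 19, 0)],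
  [([], 14, 0), ([], 13, 0), ([8], 22, 16), ([18, 57, 50, 55], 24, 28), ([0], 22, 33), ([3, 3, 49, 49, 4], 13, 26), ([45, 56, 35], 14, 49), ([5, 48], 24, 8), ([3, 1], 24, 3), ([18, 50, 55], 13, 19), ([3], 14, 23), ([5, 51, 4], 24, 47), ([17, 67, 54, 2], 22, 12), ([3, 1, 49, 4], 13, 14), ([6, 55, 40, 20], 22, 52), ([45, 37, 54, 6], 14, 26)]]

/-- Generators of the finite group. -/
def fgens : List M5 := [
  ⟨0,1,0,0,0,1,0,0,0,0,0,0,1,0,0,0,0,0,1,0,0,0,0,0,1⟩,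
  ⟨0,0,1,0,0,0,0,0,1,0,1,0,0,0,0,0,1,0,0,0,0,0,0,0,1⟩,
  ⟨1,0,0,0,0,0,1,0,0,0,0,0,1,0,0,0,0,0,1,0,0,0,0,0,-1⟩,
  ⟨-1,0,0,0,0,0,-1,0,0,0,0,0,1,0,0,0,0,0,1,0,0,0,0,0,1⟩]

/-- Unipotent generators. -/
def ugens : List M5 := [
  ⟨1,0,0,1,0,0,1,0,0,0,0,-1,1,0,0,0,0,0,1,0,0,0,0,0,1⟩,
  ⟨1,0,0,-1,0,0,1,0,0,0,0,1,1,0,0,0,0,0,1,0,0,0,0,0,1⟩,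
  ⟨1,-2,0,0,-4,0,1,0,0,0,0,0,1,0,0,0,0,0,1,0,0,1,0,0,1⟩,
  ⟨1,-2,0,0,4,0,1,0,0,0,0,0,1,0,0,0,0,0,1,0,0,-1,0,0,1⟩]

/-- The finite group as words in its generators. -/
def fwords : List (List ℕ) := [
  [],
  [0],
  [1],
  [2],
  [3],
  [0, 1],
  [0, 2],
  [0, 3],
  [1, 0],
  [1, 2],
  [1, 3],
  [2, 3],
  [3, 1],
  [0, 1, 0],
  [0, 1, 2],
  [0, 1, 3],
  [0, 2, 3],
  [0, 3, 1],
  [1, 0, 1],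
  [1, 0, 2],
  [1, 0, 3],
  [1, 2, 3],
  [1, 3, 1],
  [2, 3, 1],
  [3, 1, 0],
  [3, 1, 3],
  [0, 1, 0, 1],
  [0, 1, 0, 2],
  [0, 1, 0, 3],
  [0, 1, 2, 3],
  [0, 1, 3, 1],
  [0, 2, 3, 1],
  [0, 3, 1, 0],
  [0, 3, 1, 3],
  [1, 0, 1, 2],
  [1, 0, 1, 3],
  [1, 0, 2, 3],
  [1, 0, 3, 1],
  [1, 2, 3, 1],
  [1, 3, 1, 3],
  [2, 3, 1, 0],
  [2, 3, 1, 3],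
  [3, 1, 0, 3],
  [0, 1, 0, 1, 2],
  [0, 1, 0, 1, 3],
  [0, 1, 0, 2, 3],
  [0, 1, 0, 3, 1],
  [0, 1, 2, 3, 1],
  [0, 1, 3, 1, 3],
  [0, 2, 3, 1, 0],
  [0, 2, 3, 1, 3],
  [0, 3, 1, 0, 3],
  [1, 0, 1, 2, 3],
  [1, 0, 2, 3, 1],
  [1, 0, 3, 1, 3],
  [1, 2, 3, 1, 3],
  [2, 3, 1, 0, 3],
  [0, 1, 0, 1, 2, 3],
  [0, 1, 0, 2, 3, 1],
  [0, 1, 0, 3, 1, 3],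
  [0, 1, 2, 3, 1, 3],
  [0, 2, 3, 1, 0, 3],
  [1, 0, 2, 3, 1, 3],
  [0, 1, 0, 2, 3, 1, 3]]

theorem gens_check : zipAll eqb gensl (gens0 ++ steps.map Prod.fst) = true := by decide +kernel

theorem steps_check : stepsOk gens0 steps = true := by decide +kernel

theorem F_check : (Fl.all fun f => fgens.all fun g => mem (mul f g) Fl) = true := by
  decide +kernel

theorem FW_check : zipAll (fun f w => eqb (word fgens w) f) Fl fwords = true := by
  decide +kernel

theorem GU_check :
    (Ul.all fun u => fgens.all fun g => mem (mul g u) (Ul.map fun v => mul v g)) = true := by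
  decide +kernel

theorem UU_check : (ugens.all fun u => mem u Ul) = true := by
  decide +kernel

theorem certs_check : zipAll (fun s row => zipAll (fun u c =>
      eqb (mul s u) (mul (word gensl c.1) (mul (Sl.getD c.2.1 one) (Fl.getD c.2.2 one))))
      Ul row) Sl certs = true := by
  decide +kernel
/-! ### Reduction theory of the form `2 x₁ y₁ + 2 x₂ y₂ + 4 z²` -/

abbrev Mat := Matrix (Fin 5) (Fin 5) ℤ

def J : Mat := !![0, 1, 0, 0, 0; 1, 0, 0, 0, 0; 0, 0, 0, 1, 0; 0, 0, 1, 0, 0; 0, 0, 0, 0, 4]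

def sm : Mat := !![0, 1, 0, 0, 0; 1, 0, 0, 0, 0; 0, 0, 1, 0, 0; 0, 0, 0, 1, 0; 0, 0, 0, 0, 1]
def tm : Mat := !![0, 0, 1, 0, 0; 0, 0, 0, 1, 0; 1, 0, 0, 0, 0; 0, 1, 0, 0, 0; 0, 0, 0, 0, 1]
def rm : Mat := !![1, 0, 0, 0, 0; 0, 1, 0, 0, 0; 0, 0, 1, 0, 0; 0, 0, 0, 1, 0; 0, 0, 0, 0, -1]
def nm : Mat := !![-1, 0, 0, 0, 0; 0, -1, 0, 0, 0; 0, 0, 1, 0, 0; 0, 0, 0, 1, 0; 0, 0, 0, 0, 1]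
def em (t : ℤ) : Mat :=
  !![1, 0, 0, t, 0; 0, 1, 0, 0, 0; 0, -t, 1, 0, 0; 0, 0, 0, 1, 0; 0, 0, 0, 0, 1]
def zm (t : ℤ) : Mat :=
  !![1, -2 * t ^ 2, 0, 0, -4 * t; 0, 1, 0, 0, 0; 0, 0, 1, 0, 0; 0, 0, 0, 1, 0; 0, t, 0, 0, 1]

def genSet : Set Mat := {sm, tm, rm, nm, em 1, em (-1), zm 1, zm (-1)}

/-- The group generated by the elementary isometries. -/
def K : Submonoid Mat := Submonoid.closure genSet

theorem sm_mem : sm ∈ K := Submonoid.subset_closure (by simp [genSet])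
theorem tm_mem : tm ∈ K := Submonoid.subset_closure (by simp [genSet])
theorem rm_mem : rm ∈ K := Submonoid.subset_closure (by simp [genSet])
theorem nm_mem : nm ∈ K := Submonoid.subset_closure (by simp [genSet])

theorem em_add (s t : ℤ) : em s * em t = em (s + t) := by
  ext i j
  fin_cases i <;> fin_cases j <;> simp [em, Matrix.mul_apply, Fin.sum_univ_succ] <;> ring

theorem zm_add (s t : ℤ) : zm s * zm t = zm (s + t) := by
  ext i j
  fin_cases i <;> fin_cases j <;> simp [zm, Matrix.mul_apply, Fin.sum_univ_succ] <;> ring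

theorem em_zero : em 0 = 1 := by
  ext i j
  fin_cases i <;> fin_cases j <;> simp [em]

theorem zm_zero : zm 0 = 1 := by
  ext i j
  fin_cases i <;> fin_cases j <;> simp [zm]

theorem em_mem (t : ℤ) : em t ∈ K := by
  induction t using Int.induction_on with
  | zero => rw [em_zero]; exact K.one_mem
  | succ k ih =>
    rw [← em_add]; exact K.mul_mem ih (Submonoid.subset_closure (by simp [genSet]))
  | pred k ih =>
    rw [sub_eq_add_neg, ← em_add]
    exact K.mul_mem ih (Submonoid.subset_closure (by simp [genSet]))

theorem zm_mem (t : ℤ) : zm t ∈ K := by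
  induction t using Int.induction_on with
  | zero => rw [zm_zero]; exact K.one_mem
  | succ k ih =>
    rw [← zm_add]; exact K.mul_mem ih (Submonoid.subset_closure (by simp [genSet]))
  | pred k ih =>
    rw [sub_eq_add_neg, ← zm_add]
    exact K.mul_mem ih (Submonoid.subset_closure (by simp [genSet]))

theorem sm_sm : sm * sm = 1 := by decide +kernel
theorem tm_tm : tm * tm = 1 := by decide +kernel
theorem rm_rm : rm * rm = 1 := by decide +kernel
theorem nm_nm : nm * nm = 1 := by decide +kernel

theorem K_iso {k : Mat} (hk : k ∈ K) : kᵀ * J * k = J := by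
  induction hk using Submonoid.closure_induction with
  | mem x hx =>
    simp only [genSet, Set.mem_insert_iff, Set.mem_singleton_iff] at hx
    rcases hx with rfl | rfl | rfl | rfl | rfl | rfl | rfl | rfl <;> decide +kernel
  | one => simp
  | mul x y _ _ hx hy =>
    calc (x * y)ᵀ * J * (x * y) = yᵀ * (xᵀ * J * x) * y := by
          simp only [Matrix.transpose_mul, Matrix.mul_assoc]
      _ = J := by rw [hx, hy]

/-- `v` can be moved to `w` by an element of `K` fixing the basis vectors in `S`. -/
def VR (S : Set (Fin 5)) (v w : Fin 5 → ℤ) : Prop :=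
  ∃ k ∈ K, ∃ k' ∈ K, k * k' = 1 ∧ k' *ᵥ v = w ∧
    ∀ i ∈ S, (k' *ᵥ fun j => (1 : Mat) j i) = fun j => (1 : Mat) j i

theorem VR.refl (S : Set (Fin 5)) (v : Fin 5 → ℤ) : VR S v v :=
  ⟨1, K.one_mem, 1, K.one_mem, by simp, by simp, by simp⟩

theorem VR.trans {S : Set (Fin 5)} {u v w : Fin 5 → ℤ} (h : VR S u v) (h' : VR S v w) :
    VR S u w := by
  obtain ⟨k, hk, l, hl, e, f, g⟩ := h
  obtain ⟨k', hk', l', hl', e', f', g'⟩ := h'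
  refine ⟨k * k', K.mul_mem hk hk', l' * l, K.mul_mem hl' hl, ?_, ?_, ?_⟩
  · calc k * k' * (l' * l) = k * (k' * l') * l := by simp only [Matrix.mul_assoc]
      _ = 1 := by rw [e', Matrix.mul_one, e]
  · rw [← Matrix.mulVec_mulVec, f, f']
  · intro i hi
    rw [← Matrix.mulVec_mulVec, g i hi, g' i hi]

theorem vr_s (S : Set (Fin 5)) (hS : S ⊆ {2, 3, 4}) (a b c d e : ℤ) :
    VR S ![a, b, c, d, e] ![b, a, c, d, e] := by
  refine ⟨sm, sm_mem, sm, sm_mem, sm_sm, ?_, ?_⟩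
  · ext i; fin_cases i <;> simp [sm, Matrix.mulVec, dotProduct, Fin.sum_univ_succ]
  · intro i hi
    have := hS hi
    simp only [Set.mem_insert_iff, Set.mem_singleton_iff] at this
    rcases this with rfl | rfl | rfl <;> decide +kernel

theorem vr_n (S : Set (Fin 5)) (hS : S ⊆ {2, 3, 4}) (a b c d e : ℤ) :
    VR S ![a, b, c, d, e] ![-a, -b, c, d, e] := by
  refine ⟨nm, nm_mem, nm, nm_mem, nm_nm, ?_, ?_⟩
  · ext i; fin_cases i <;> simp [nm, Matrix.mulVec, dotProduct, Fin.sum_univ_succ]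
  · intro i hi
    have := hS hi
    simp only [Set.mem_insert_iff, Set.mem_singleton_iff] at this
    rcases this with rfl | rfl | rfl <;> decide +kernel

theorem vr_t (a b c d e : ℤ) :
    VR ∅ ![a, b, c, d, e] ![c, d, a, b, e] := by
  refine ⟨tm, tm_mem, tm, tm_mem, tm_tm, ?_, by simp⟩
  ext i; fin_cases i <;> simp [tm, Matrix.mulVec, dotProduct, Fin.sum_univ_succ]

theorem vr_e (S : Set (Fin 5)) (hS : S ⊆ {0, 2}) (t a b c d e : ℤ) :
    VR S ![a, b, c, d, e] ![a + t * d, b, c - t * b, d, e] := by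
  refine ⟨em (-t), em_mem _, em t, em_mem _, by rw [em_add]; simp [em_zero], ?_, ?_⟩
  · ext i; fin_cases i <;> simp [em, Matrix.mulVec, dotProduct, Fin.sum_univ_succ]
    ring
  · intro i hi
    have := hS hi
    simp only [Set.mem_insert_iff, Set.mem_singleton_iff] at this
    rcases this with rfl | rfl <;> ext j <;> fin_cases j <;>
      simp [em, Matrix.mulVec, dotProduct, Fin.sum_univ_succ] <;> rfl

theorem vr_z (S : Set (Fin 5)) (hS : S ⊆ {0, 2, 3}) (t a b c d e : ℤ) :
    VR S ![a, b, c, d, e] ![a - 4 * t * e - 2 * t ^ 2 * b, b, c, d, e + t * b] := by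
  refine ⟨zm (-t), zm_mem _, zm t, zm_mem _, by rw [zm_add]; simp [zm_zero], ?_, ?_⟩
  · ext i; fin_cases i <;> simp [zm, Matrix.mulVec, dotProduct, Fin.sum_univ_succ] <;> ring
  · intro i hi
    have := hS hi
    simp only [Set.mem_insert_iff, Set.mem_singleton_iff] at this
    rcases this with rfl | rfl | rfl <;> ext j <;> fin_cases j <;>
      simp [zm, Matrix.mulVec, dotProduct, Fin.sum_univ_succ] <;> rfl

/-- the move `z` for the second hyperbolic plane -/
theorem vr_z2 (t a b c d e : ℤ) :
    VR {2} ![a, b, c, d, e] ![a, b, c - 4 * t * e - 2 * t ^ 2 * d, d, e + t * d] := by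
  refine ⟨tm * zm (-t) * tm, K.mul_mem (K.mul_mem tm_mem (zm_mem _)) tm_mem,
    tm * zm t * tm, K.mul_mem (K.mul_mem tm_mem (zm_mem _)) tm_mem, ?_, ?_, ?_⟩
  · calc tm * zm (-t) * tm * (tm * zm t * tm) = tm * (zm (-t) * (tm * tm) * zm t) * tm := by
          simp only [Matrix.mul_assoc]
      _ = 1 := by rw [tm_tm, Matrix.mul_one, zm_add]; simp [zm_zero, tm_tm]
  · rw [← Matrix.mulVec_mulVec, ← Matrix.mulVec_mulVec]
    ext i; fin_cases i <;> simp [tm, zm, Matrix.mulVec, dotProduct, Fin.sum_univ_succ] <;> ring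
  · intro i hi
    simp only [Set.mem_singleton_iff] at hi
    subst hi
    rw [← Matrix.mulVec_mulVec, ← Matrix.mulVec_mulVec]
    ext j; fin_cases j <;>
      simp [tm, zm, Matrix.mulVec, dotProduct, Fin.sum_univ_succ] <;> rfl

theorem centered (e b : ℤ) (hb : b ≠ 0) : ∃ t : ℤ, 2 * |e + t * b| ≤ |b| := by
  have h0 := Int.emod_nonneg e hb
  have h1 := Int.emod_lt_abs e hb
  have h2 := Int.emod_add_mul_ediv e b
  by_cases h : 2 * (e % b) ≤ |b|
  · refine ⟨-(e / b), ?_⟩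
    have : e + -(e / b) * b = e % b := by linarith
    rw [this, abs_of_nonneg h0]; exact h
  · rcases abs_cases b with ⟨hb', _⟩ | ⟨hb', _⟩
    · refine ⟨-(e / b) - 1, ?_⟩
      have : e + (-(e / b) - 1) * b = e % b - b := by linarith
      rw [this, abs_of_nonpos (by linarith)]
      linarith
    · refine ⟨-(e / b) + 1, ?_⟩
      have : e + (-(e / b) + 1) * b = e % b + b := by linarith
      rw [this, abs_of_nonpos (by linarith)]
      linarith

theorem descent {a b z : ℤ} (hb : b ≠ 0) (h : a * b + 2 * z ^ 2 = 0) (hz : 2 * |z| ≤ |b|) :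
    |a| < |b| := by
  have h1 : |a| * |b| = 2 * |z| ^ 2 := by
    rw [← abs_mul, sq_abs, show a * b = -(2 * z ^ 2) by linarith, abs_neg,
      abs_of_nonneg (by positivity)]
  have hb' : 0 < |b| := abs_pos.2 hb
  have hz' : 0 ≤ |z| := abs_nonneg z
  by_contra hc
  push Not at hc
  nlinarith

/-- Reduction of isotropic vectors in the ternary lattice. -/
theorem red3 (n : ℕ) : ∀ a b e : ℤ, b ≠ 0 → b.natAbs ≤ n → a * b + 2 * e ^ 2 = 0 →
    ∃ m, VR {2, 3} ![a, b, 0, 0, e] ![m, 0, 0, 0, 0] := by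
  have hS : ({2, 3} : Set (Fin 5)) ⊆ {2, 3, 4} := by intro x; simp; tauto
  have hS' : ({2, 3} : Set (Fin 5)) ⊆ {0, 2, 3} := by intro x; simp; tauto
  induction n with
  | zero => intro a b e hb hn; omega
  | succ n ih =>
    intro a b e hb hn h
    obtain ⟨t, ht⟩ := centered e b hb
    set e' := e + t * b with he'
    set a' := a - 4 * t * e - 2 * t ^ 2 * b with ha'
    have h' : a' * b + 2 * e' ^ 2 = 0 := by rw [ha', he']; linarith
    have hd := descent hb h' ht
    rw [Int.abs_eq_natAbs, Int.abs_eq_natAbs, Nat.cast_lt] at hd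
    have h1 : VR {2, 3} ![a, b, 0, 0, e] ![a', b, 0, 0, e'] := vr_z _ hS' t a b 0 0 e
    have h2 : VR {2, 3} ![a', b, 0, 0, e'] ![b, a', 0, 0, e'] := vr_s _ hS a' b 0 0 e'
    by_cases ha : a' = 0
    · refine ⟨b, (h1.trans h2).trans ?_⟩
      have : e' = 0 := by
        rw [ha] at h'
        have : e' ^ 2 = 0 := by linarith
        exact pow_eq_zero_iff (two_ne_zero) |>.1 this
      rw [ha, this]; exact VR.refl _ _
    · obtain ⟨m, hm⟩ := ih b a' e' ha (by omega) (by linarith)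
      exact ⟨m, (h1.trans h2).trans hm⟩

/-- Reduction of isotropic vectors in the full lattice. -/
theorem red5 (n : ℕ) : ∀ a b c d e : ℤ, b ≠ 0 → b.natAbs ≤ n →
    a * b + c * d + 2 * e ^ 2 = 0 →
    ∃ m, VR ∅ ![a, b, c, d, e] ![m, 0, 0, 0, 0] := by
  have hS : (∅ : Set (Fin 5)) ⊆ {2, 3, 4} := Set.empty_subset _
  have hS' : (∅ : Set (Fin 5)) ⊆ {0, 2, 3} := Set.empty_subset _
  have hS2 : (∅ : Set (Fin 5)) ⊆ {0, 2} := Set.empty_subset _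
  induction n with
  | zero => intro a b c d e hb hn; omega
  | succ n ih =>
    -- it suffices to treat the case `c = 0`, then `d = 0`
    have key1 : ∀ a b e : ℤ, b ≠ 0 → b.natAbs ≤ n + 1 → a * b + 2 * e ^ 2 = 0 →
        ∃ m, VR ∅ ![a, b, 0, 0, e] ![m, 0, 0, 0, 0] := by
      intro a b e hb hn h
      obtain ⟨m, k, hk, k', hk', h1, h2, -⟩ := red3 (n + 1) a b e hb hn h
      exact ⟨m, k, hk, k', hk', h1, h2, by simp⟩
    have key2 : ∀ a b d e : ℤ, b ≠ 0 → b.natAbs ≤ n + 1 → a * b + 2 * e ^ 2 = 0 →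
        ∃ m, VR ∅ ![a, b, 0, d, e] ![m, 0, 0, 0, 0] := by
      intro a b d e hb hn h
      -- swap the entries of the second plane, reduce
      have h1 : VR ∅ ![a, b, 0, d, e] ![a, b, d, 0, e] :=
        ((vr_t a b 0 d e).trans (vr_s _ hS 0 d a b e)).trans (vr_t d 0 a b e)
      have h2 : VR ∅ ![a, b, d, 0, e] ![a, b, d % b, 0, e] := by
        have := vr_e _ hS2 (d / b) a b d 0 e
        have e1 : d - d / b * b = d % b := by linarith [Int.emod_add_mul_ediv d b]
        rw [mul_zero, add_zero, e1] at this
        exact this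
      by_cases hd : d % b = 0
      · obtain ⟨m, hm⟩ := key1 a b e hb hn h
        rw [hd] at h2
        exact ⟨m, (h1.trans h2).trans hm⟩
      · have h3 : VR ∅ ![a, b, d % b, 0, e] ![0, d % b, a, b, e] :=
          (vr_t a b (d % b) 0 e).trans (vr_s _ hS (d % b) 0 a b e)
        have l0 := Int.emod_nonneg d hb
        have l1 := Int.emod_lt_abs d hb
        rw [Int.abs_eq_natAbs] at l1
        obtain ⟨m, hm⟩ := ih 0 (d % b) a b e hd (by omega) (by linarith)
        exact ⟨m, ((h1.trans h2).trans h3).trans hm⟩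
    intro a b c d e hb hn h
    have h2 : VR ∅ ![a, b, c, d, e] ![a + c / b * d, b, c % b, d, e] := by
      have := vr_e _ hS2 (c / b) a b c d e
      have e1 : c - c / b * b = c % b := by linarith [Int.emod_add_mul_ediv c b]
      rw [e1] at this
      exact this
    have h' : (a + c / b * d) * b + (c % b) * d + 2 * e ^ 2 = 0 := by
      have e1 : c % b = c - c / b * b := by linarith [Int.emod_add_mul_ediv c b]
      rw [e1]; linarith
    by_cases hc : c % b = 0
    · rw [hc] at h2 h'
      obtain ⟨m, hm⟩ := key2 (a + c / b * d) b d e hb hn (by linarith)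
      exact ⟨m, h2.trans hm⟩
    · have h3 : VR ∅ ![a + c / b * d, b, c % b, d, e] ![d, c % b, a + c / b * d, b, e] :=
        (vr_t (a + c / b * d) b (c % b) d e).trans (vr_s _ hS (c % b) d (a + c / b * d) b e)
      have l0 := Int.emod_nonneg c hb
      have l1 := Int.emod_lt_abs c hb
      rw [Int.abs_eq_natAbs] at l1
      obtain ⟨m, hm⟩ := ih d (c % b) (a + c / b * d) b e hc (by omega) (by linarith)
      exact ⟨m, (h2.trans h3).trans hm⟩

theorem red3' (a b e : ℤ) (h : a * b + 2 * e ^ 2 = 0) :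
    ∃ m, VR {2, 3} ![a, b, 0, 0, e] ![m, 0, 0, 0, 0] := by
  by_cases hb : b = 0
  · refine ⟨a, ?_⟩
    have : e = 0 := by
      rw [hb] at h
      have : e ^ 2 = 0 := by linarith
      exact pow_eq_zero_iff (two_ne_zero) |>.1 this
    rw [hb, this]; exact VR.refl _ _
  · exact red3 _ a b e hb le_rfl h

theorem red5' (a b c d e : ℤ) (h : a * b + c * d + 2 * e ^ 2 = 0) :
    ∃ m, VR ∅ ![a, b, c, d, e] ![m, 0, 0, 0, 0] := by
  have hS : (∅ : Set (Fin 5)) ⊆ {2, 3, 4} := Set.empty_subset _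
  by_cases hb : b = 0
  · by_cases ha : a = 0
    · by_cases hd : d = 0
      · obtain ⟨m, k, hk, k', hk', h1, h2, -⟩ := red3' c d e (by rw [ha] at h; linarith)
        have h3 : VR ∅ ![c, d, 0, 0, e] ![m, 0, 0, 0, 0] := ⟨k, hk, k', hk', h1, h2, by simp⟩
        refine ⟨m, VR.trans ?_ h3⟩
        rw [ha, hb]
        exact vr_t 0 0 c d e
      · obtain ⟨m, hm⟩ := red5 _ c d a b e hd le_rfl (by linarith)
        exact ⟨m, (vr_t a b c d e).trans hm⟩
    · obtain ⟨m, hm⟩ := red5 _ b a c d e ha le_rfl (by linarith)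
      exact ⟨m, (vr_s _ hS a b c d e).trans hm⟩
  · exact red5 _ a b c d e hb le_rfl h

theorem iso_entry {X : Mat} (hX : Xᵀ * J * X = J) (i j : Fin 5) :
    X 0 i * X 1 j + X 1 i * X 0 j + X 2 i * X 3 j + X 3 i * X 2 j + 4 * X 4 i * X 4 j = J i j := by
  rw [← hX]
  simp [J, Matrix.mul_apply, Fin.sum_univ_succ]
  ring

theorem col_eq (X : Mat) (c : Fin 5) :
    (fun j => X j c) = ![X 0 c, X 1 c, X 2 c, X 3 c, X 4 c] := by
  ext i; fin_cases i <;> rfl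

/-- An isometry whose columns indexed by `S` are standard. -/
def Std (S : Set (Fin 5)) (X : Mat) : Prop :=
  Xᵀ * J * X = J ∧ ∀ i ∈ S, (fun j => X j i) = fun j => (1 : Mat) j i

theorem Std.step {S : Set (Fin 5)} {X : Mat} (hX : Std S X) (c : Fin 5) {w : Fin 5 → ℤ}
    (h : VR S ![X 0 c, X 1 c, X 2 c, X 3 c, X 4 c] w) :
    ∃ k ∈ K, ∃ Y, X = k * Y ∧ Std S Y ∧ (fun j => Y j c) = w := by
  obtain ⟨k, hk, k', hk', h1, h2, h3⟩ := h
  rw [← col_eq] at h2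
  have hcol : ∀ i, (fun j => (k' * X) j i) = k' *ᵥ fun j => X j i := by
    intro i; ext j; rfl
  refine ⟨k, hk, k' * X, ?_, ⟨?_, ?_⟩, ?_⟩
  · rw [← Matrix.mul_assoc, h1, Matrix.one_mul]
  · calc (k' * X)ᵀ * J * (k' * X) = Xᵀ * (k'ᵀ * J * k') * X := by
          simp only [Matrix.transpose_mul, Matrix.mul_assoc]
      _ = J := by rw [K_iso hk', hX.1]
  · intro i hi
    rw [hcol, hX.2 i hi, h3 i hi]
  · rw [hcol, h2]

theorem mem_of_step {S T : Set (Fin 5)} {c : Fin 5}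
    (ih : ∀ Y, Std T Y → Y ∈ K) (hT : ∀ i ∈ T, i ∈ S ∨ i = c)
    {X : Mat} (hX : Std S X) {w : Fin 5 → ℤ}
    (h : VR S ![X 0 c, X 1 c, X 2 c, X 3 c, X 4 c] w)
    (hw : ∀ Y, Std S Y → (fun j => Y j c) = w → (fun j => Y j c) = fun j => (1 : Mat) j c) :
    X ∈ K := by
  obtain ⟨k, hk, Y, rfl, hY, hYc⟩ := hX.step c h
  refine K.mul_mem hk (ih Y ⟨hY.1, fun i hi => ?_⟩)
  rcases hT i hi with h | rfl
  · exact hY.2 i h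
  · exact hw Y hY hYc

theorem vecs_eq {a b c d e a' b' c' d' e' : ℤ}
    (h : a = a' ∧ b = b' ∧ c = c' ∧ d = d' ∧ e = e') :
    ![a, b, c, d, e] = ![a', b', c', d', e'] := by
  obtain ⟨rfl, rfl, rfl, rfl, rfl⟩ := h; rfl

theorem col_entries {X : Mat} {c : Fin 5} {w : Fin 5 → ℤ} (h : (fun j => X j c) = w) :
    X 0 c = w 0 ∧ X 1 c = w 1 ∧ X 2 c = w 2 ∧ X 3 c = w 3 ∧ X 4 c = w 4 := by
  subst h; exact ⟨rfl, rfl, rfl, rfl, rfl⟩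

theorem one_col0 : (fun j => (1 : Mat) j 0) = ![1, 0, 0, 0, 0] := by decide
theorem one_col1 : (fun j => (1 : Mat) j 1) = ![0, 1, 0, 0, 0] := by decide
theorem one_col2 : (fun j => (1 : Mat) j 2) = ![0, 0, 1, 0, 0] := by decide
theorem one_col3 : (fun j => (1 : Mat) j 3) = ![0, 0, 0, 1, 0] := by decide

theorem Std.col0 {S : Set (Fin 5)} {X : Mat} (hX : Std S X) (h : 0 ∈ S) :
    X 0 0 = 1 ∧ X 1 0 = 0 ∧ X 2 0 = 0 ∧ X 3 0 = 0 ∧ X 4 0 = 0 :=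
  col_entries ((hX.2 0 h).trans one_col0)
theorem Std.col1 {S : Set (Fin 5)} {X : Mat} (hX : Std S X) (h : 1 ∈ S) :
    X 0 1 = 0 ∧ X 1 1 = 1 ∧ X 2 1 = 0 ∧ X 3 1 = 0 ∧ X 4 1 = 0 :=
  col_entries ((hX.2 1 h).trans one_col1)
theorem Std.col2 {S : Set (Fin 5)} {X : Mat} (hX : Std S X) (h : 2 ∈ S) :
    X 0 2 = 0 ∧ X 1 2 = 0 ∧ X 2 2 = 1 ∧ X 3 2 = 0 ∧ X 4 2 = 0 :=
  col_entries ((hX.2 2 h).trans one_col2)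
theorem Std.col3 {S : Set (Fin 5)} {X : Mat} (hX : Std S X) (h : 3 ∈ S) :
    X 0 3 = 0 ∧ X 1 3 = 0 ∧ X 2 3 = 0 ∧ X 3 3 = 1 ∧ X 4 3 = 0 :=
  col_entries ((hX.2 3 h).trans one_col3)

theorem J_vals : J 0 1 = 1 ∧ J 2 3 = 1 ∧ J 0 0 = 0 ∧ J 1 1 = 0 ∧ J 2 2 = 0 ∧ J 3 3 = 0 ∧
    J 0 2 = 0 ∧ J 0 3 = 0 ∧ J 1 2 = 0 ∧ J 1 3 = 0 ∧ J 0 4 = 0 ∧ J 1 4 = 0 ∧ J 2 4 = 0 ∧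
    J 3 4 = 0 ∧ J 4 4 = 4 := by decide

theorem lev4 (X : Mat) (hX : Std {0, 1, 2, 3} X) : X ∈ K := by
  obtain ⟨a0, a1, a2, a3, a4⟩ := hX.col0 (by simp)
  obtain ⟨b0, b1, b2, b3, b4⟩ := hX.col1 (by simp)
  obtain ⟨c0, c1, c2, c3, c4⟩ := hX.col2 (by simp)
  obtain ⟨d0, d1, d2, d3, d4⟩ := hX.col3 (by simp)
  obtain ⟨-, -, -, -, -, -, -, -, -, -, j04, j14, j24, j34, j44⟩ := J_vals
  have e0 := iso_entry hX.1 1 4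
  have e1 := iso_entry hX.1 0 4
  have e2 := iso_entry hX.1 3 4
  have e3 := iso_entry hX.1 2 4
  have e4 := iso_entry hX.1 4 4
  rw [b0, b1, b2, b3, b4, j14] at e0
  rw [a0, a1, a2, a3, a4, j04] at e1
  rw [d0, d1, d2, d3, d4, j34] at e2
  rw [c0, c1, c2, c3, c4, j24] at e3
  have f0 : X 0 4 = 0 := by linarith
  have f1 : X 1 4 = 0 := by linarith
  have f2 : X 2 4 = 0 := by linarith
  have f3 : X 3 4 = 0 := by linarith
  rw [f0, f1, f2, f3, j44] at e4
  have f4 : X 4 4 * X 4 4 = 1 := by linarith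
  rcases Int.eq_one_or_neg_one_of_mul_eq_one f4 with h | h
  · have : X = 1 := by
      ext i j
      fin_cases i <;> fin_cases j <;> simpa
    rw [this]; exact K.one_mem
  · have : X = rm := by
      ext i j
      fin_cases i <;> fin_cases j <;> simpa [rm]
    rw [this]; exact rm_mem

theorem lev3 (X : Mat) (hX : Std {0, 2, 3} X) : X ∈ K := by
  have facts : ∀ Y, Std {0, 2, 3} Y → Y 1 1 = 1 ∧ Y 2 1 = 0 ∧ Y 3 1 = 0 ∧
      Y 0 1 * Y 1 1 + 2 * Y 4 1 ^ 2 = 0 := by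
    intro Y hY
    obtain ⟨a0, a1, a2, a3, a4⟩ := hY.col0 (by simp)
    obtain ⟨c0, c1, c2, c3, c4⟩ := hY.col2 (by simp)
    obtain ⟨d0, d1, d2, d3, d4⟩ := hY.col3 (by simp)
    obtain ⟨j01, -, -, j11, -, -, -, -, j12, j13, -⟩ := J_vals
    have e1 := iso_entry hY.1 0 1
    have e2 := iso_entry hY.1 1 3
    have e3 := iso_entry hY.1 1 2
    have e4 := iso_entry hY.1 1 1
    rw [a0, a1, a2, a3, a4, j01] at e1
    rw [d0, d1, d2, d3, d4, j13] at e2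
    rw [c0, c1, c2, c3, c4, j12] at e3
    rw [j11] at e4
    have f2 : Y 2 1 = 0 := by linarith
    have f3 : Y 3 1 = 0 := by linarith
    rw [f2, f3] at e4
    exact ⟨by linarith, f2, f3, by linarith⟩
  obtain ⟨h1, h2, h3, h4⟩ := facts X hX
  have hv := vr_z {0, 2, 3} subset_rfl (-X 4 1) (X 0 1) (X 1 1) (X 2 1) (X 3 1) (X 4 1)
  refine mem_of_step (c := 1) lev4 (by intro i; simp; tauto) hX hv ?_
  intro Y hY hc
  obtain ⟨g1, g2, g3, g4⟩ := facts Y hY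
  have g5 : Y 4 1 = X 4 1 + -X 4 1 * X 1 1 := (col_entries hc).2.2.2.2
  have g6 : Y 4 1 = 0 := by rw [g5, h1]; ring
  rw [g1, g6] at g4
  rw [col_eq, one_col1]
  exact vecs_eq ⟨by linarith, g1, g2, g3, g6⟩

theorem lev2 (X : Mat) (hX : Std {2, 3} X) : X ∈ K := by
  have hS : ({2, 3} : Set (Fin 5)) ⊆ {2, 3, 4} := by intro x; simp; tauto
  have facts : ∀ Y, Std {2, 3} Y → Y 2 0 = 0 ∧ Y 3 0 = 0 ∧
      Y 0 0 * Y 1 0 + 2 * Y 4 0 ^ 2 = 0 := by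
    intro Y hY
    obtain ⟨c0, c1, c2, c3, c4⟩ := hY.col2 (by simp)
    obtain ⟨d0, d1, d2, d3, d4⟩ := hY.col3 (by simp)
    obtain ⟨-, -, j00, -, -, -, j02, j03, -⟩ := J_vals
    have e2 := iso_entry hY.1 0 3
    have e3 := iso_entry hY.1 0 2
    have e4 := iso_entry hY.1 0 0
    rw [d0, d1, d2, d3, d4, j03] at e2
    rw [c0, c1, c2, c3, c4, j02] at e3
    rw [j00] at e4
    have f2 : Y 2 0 = 0 := by linarith
    have f3 : Y 3 0 = 0 := by linarith
    rw [f2, f3] at e4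
    exact ⟨f2, f3, by linarith⟩
  obtain ⟨h2, h3, h4⟩ := facts X hX
  obtain ⟨m, hm⟩ := red3' _ _ _ h4
  have hm' : VR {2, 3} ![X 0 0, X 1 0, X 2 0, X 3 0, X 4 0] ![m, 0, 0, 0, 0] := by
    rw [h2, h3]; exact hm
  have hm1 : m = 1 ∨ m = -1 := by
    obtain ⟨k, hk, Y, -, hY, hYc⟩ := hX.step 0 hm'
    obtain ⟨y0, y1, y2, y3, y4⟩ := col_entries hYc
    have e := iso_entry hY.1 0 1
    rw [y0, y1, y2, y3, y4, J_vals.1] at e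
    have e' : m * Y 1 1 = 1 := by
      rw [← e]
      simp
    exact Int.eq_one_or_neg_one_of_mul_eq_one e'
  have hv : VR {2, 3} ![X 0 0, X 1 0, X 2 0, X 3 0, X 4 0] ![1, 0, 0, 0, 0] := by
    rcases hm1 with rfl | rfl
    · exact hm'
    · exact hm'.trans (vr_n _ hS (-1) 0 0 0 0)
  refine mem_of_step (c := 0) lev3 (by intro i; simp; tauto) hX hv ?_
  intro Y _ hc
  rw [hc, one_col0]

theorem lev1 (X : Mat) (hX : Std {2} X) : X ∈ K := by
  have hS : ({2} : Set (Fin 5)) ⊆ {2, 3, 4} := by intro x; simp; tauto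
  have hS' : ({2} : Set (Fin 5)) ⊆ {0, 2} := by intro x; simp; tauto
  have facts : ∀ Y, Std {2} Y → Y 3 3 = 1 ∧
      Y 0 3 * Y 1 3 + Y 2 3 * Y 3 3 + 2 * Y 4 3 ^ 2 = 0 := by
    intro Y hY
    obtain ⟨c0, c1, c2, c3, c4⟩ := hY.col2 (by simp)
    obtain ⟨-, j23, -, -, -, j33, -⟩ := J_vals
    have e3 := iso_entry hY.1 2 3
    have e4 := iso_entry hY.1 3 3
    rw [c0, c1, c2, c3, c4, j23] at e3
    rw [j33] at e4
    exact ⟨by linarith, by linarith⟩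
  obtain ⟨h3, h4⟩ := facts X hX
  obtain ⟨c', hv⟩ : ∃ c', VR {2} ![X 0 3, X 1 3, X 2 3, X 3 3, X 4 3] ![0, 0, c', 1, 0] := by
    rw [h3]
    have v1 := vr_e _ hS' (-X 0 3) (X 0 3) (X 1 3) (X 2 3) 1 (X 4 3)
    have v2 := v1.trans (vr_s _ hS _ _ _ _ _)
    have v3 := v2.trans (vr_e _ hS' (-X 1 3) _ _ _ _ _)
    have v4 := v3.trans (vr_z2 (-X 4 3) _ _ _ _ _)
    refine ⟨X 2 3 - -X 0 3 * X 1 3 - -X 1 3 * (X 0 3 + -X 0 3 * 1) - 4 * -X 4 3 * X 4 3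
      - 2 * (-X 4 3) ^ 2 * 1, ?_⟩
    convert v4 using 1
    exact vecs_eq ⟨by ring, by ring, rfl, rfl, by ring⟩
  refine mem_of_step (c := 3) lev2 (by intro i; simp) hX hv ?_
  intro Y hY hc
  obtain ⟨g3, g4⟩ := facts Y hY
  obtain ⟨y0, y1, -, y3, y4⟩ := col_entries hc
  have z0 : Y 0 3 = 0 := y0
  have z1 : Y 1 3 = 0 := y1
  have z4 : Y 4 3 = 0 := y4
  rw [g3, z0, z1, z4] at g4
  rw [col_eq, one_col3]
  exact vecs_eq ⟨z0, z1, by linarith, g3, z4⟩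

/-- Every integral isometry is a product of elementary ones. -/
theorem iso_mem_K (X : Mat) (hX : Xᵀ * J * X = J) : X ∈ K := by
  have hX0 : Std ∅ X := ⟨hX, by simp⟩
  have e := iso_entry hX 2 2
  rw [J_vals.2.2.2.2.1] at e
  obtain ⟨m, hm⟩ := red5' (X 0 2) (X 1 2) (X 2 2) (X 3 2) (X 4 2) (by linarith)
  have hm1 : m = 1 ∨ m = -1 := by
    obtain ⟨k, hk, Y, -, hY, hYc⟩ := hX0.step 2 hm
    obtain ⟨y0, y1, y2, y3, y4⟩ := col_entries hYc
    have e := iso_entry hY.1 2 3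
    rw [y0, y1, y2, y3, y4, J_vals.2.1] at e
    have e' : m * Y 1 3 = 1 := by
      rw [← e]
      simp
    exact Int.eq_one_or_neg_one_of_mul_eq_one e'
  have hv : VR ∅ ![X 0 2, X 1 2, X 2 2, X 3 2, X 4 2] ![0, 0, 1, 0, 0] := by
    rcases hm1 with rfl | rfl
    · exact hm.trans (vr_t 1 0 0 0 0)
    · exact (hm.trans (vr_n _ (Set.empty_subset _) (-1) 0 0 0 0)).trans (vr_t 1 0 0 0 0)
  refine mem_of_step (c := 2) lev1 (by intro i; simp) hX0 hv ?_
  intro Y _ hc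
  rw [hc, one_col2]

/-! ### The finite-index argument -/

theorem word_ind {p : Mat → Prop} (h1 : p 1) (hm : ∀ x y, p x → p y → p (x * y))
    {l : List M5} (hl : ∀ m ∈ l, p m.toMat) : ∀ w : List ℕ, p (word l w).toMat := by
  have hg : ∀ k, p (l.getD k one).toMat := by
    intro k
    by_cases hk : k < l.length
    · rw [List.getD_eq_getElem _ _ hk]
      exact hl _ (List.getElem_mem hk)
    · rw [List.getD_eq_default _ _ (not_lt.1 hk), toMat_one]
      exact h1
  intro w
  induction w with
  | nil => rw [word, toMat_one]; exact h1
  | cons k ks ih =>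
    cases ks with
    | nil => rw [word]; exact hg k
    | cons k' ks' =>
      rw [word, toMat_mul]
      · exact hm _ _ (hg k) ih
      · simp

theorem steps_ind {p : Mat → Prop} (h1 : p 1) (hm : ∀ x y, p x → p y → p (x * y)) :
    ∀ (st : List (M5 × List ℕ)) (l : List M5), (∀ m ∈ l, p m.toMat) → stepsOk l st = true →
      ∀ m ∈ l ++ st.map Prod.fst, p m.toMat
  | [], l, hl, _ => by simpa using hl
  | (g, w) :: st, l, hl, h => by
    simp only [stepsOk, Bool.and_eq_true] at h
    have hg : p g.toMat := by
      rw [← eq_of_eqb h.1]; exact word_ind h1 hm hl w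
    have := steps_ind h1 hm st (l ++ [g]) (by
      intro m hmem
      rcases List.mem_append.1 hmem with h | h
      · exact hl m h
      · rw [List.mem_singleton.1 h]; exact hg) h.2
    simpa using this

theorem zipAll_mem {α β : Type} (p : α → β → Bool) :
    ∀ (l : List α) (m : List β), zipAll p l m = true → ∀ a ∈ l, ∃ b ∈ m, p a b = true
  | [], _, _, a, ha => by simp at ha
  | _ :: _, [], h, _, _ => by simp [zipAll] at h
  | c :: as, b :: bs, h, a, ha => by
      simp only [zipAll, Bool.and_eq_true] at h
      rcases List.mem_cons.1 ha with rfl | ha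
      · exact ⟨b, by simp, h.1⟩
      · obtain ⟨b', hb', h'⟩ := zipAll_mem p as bs h.2 a ha
        exact ⟨b', by simp [hb'], h'⟩

theorem gensl_ind {p : Mat → Prop} (h1 : p 1) (hm : ∀ x y, p x → p y → p (x * y))
    (h0 : ∀ m ∈ gens0, p m.toMat) : ∀ m ∈ gensl, p m.toMat := by
  intro m hmem
  obtain ⟨b, hb, he⟩ := zipAll_mem _ _ _ gens_check m hmem
  rw [eq_of_eqb he]
  exact steps_ind h1 hm steps gens0 h0 steps_check b hb

theorem getD_mem {l : List M5} (h : one ∈ l) (k : ℕ) : l.getD k one ∈ l := by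
  by_cases hk : k < l.length
  · rw [List.getD_eq_getElem _ _ hk]
    exact List.getElem_mem hk
  · rw [List.getD_eq_default _ _ (not_lt.1 hk)]
    exact h

theorem one_mem_Sl : one ∈ Sl := mem_of_mem (by decide +kernel)
theorem one_mem_Fl : one ∈ Fl := mem_of_mem (by decide +kernel)

theorem F_step {f g : M5} (hf : f ∈ Fl) (hg : g ∈ fgens) : mul f g ∈ Fl := by
  have h := F_check
  rw [List.all_eq_true] at h
  have h' := h f hf
  rw [List.all_eq_true] at h'
  exact mem_of_mem (h' g hg)

theorem F_word {f : M5} (hf : f ∈ Fl) : ∃ w, word fgens w = f := by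
  obtain ⟨w, hw⟩ := zipAll_spec _ _ _ FW_check f hf
  exact ⟨w, eq_of_eqb hw⟩

theorem F_mul {f f' : M5} (hf : f ∈ Fl) (hf' : f' ∈ Fl) :
    ∃ f'' ∈ Fl, f.toMat * f'.toMat = f''.toMat := by
  obtain ⟨w, rfl⟩ := F_word hf'
  have := word_ind (p := fun m => ∀ f ∈ Fl, ∃ f'' ∈ Fl, f.toMat * m = f''.toMat)
    (fun f hf => ⟨f, hf, by simp⟩)
    (fun x y hx hy f hf => by
      obtain ⟨f1, hf1, e1⟩ := hx f hf
      obtain ⟨f2, hf2, e2⟩ := hy f1 hf1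
      exact ⟨f2, hf2, by rw [← Matrix.mul_assoc, e1, e2]⟩)
    (l := fgens) (fun g hg f hf => ⟨mul f g, F_step hf hg, by rw [toMat_mul]⟩) w
  exact this f hf

theorem U_step {u g : M5} (hu : u ∈ Ul) (hg : g ∈ fgens) :
    ∃ v ∈ Ul, g.toMat * u.toMat = v.toMat * g.toMat := by
  have h := GU_check
  rw [List.all_eq_true] at h
  have h' := h u hu
  rw [List.all_eq_true] at h'
  have h2 := mem_of_mem (h' g hg)
  obtain ⟨v, hv, e⟩ := List.mem_map.1 h2
  exact ⟨v, hv, by rw [← toMat_mul, ← toMat_mul, e]⟩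

theorem F_U {f u : M5} (hf : f ∈ Fl) (hu : u ∈ Ul) :
    ∃ v ∈ Ul, f.toMat * u.toMat = v.toMat * f.toMat := by
  obtain ⟨w, rfl⟩ := F_word hf
  have := word_ind (p := fun m => ∀ u ∈ Ul, ∃ v ∈ Ul, m * u.toMat = v.toMat * m)
    (fun f hf => ⟨f, hf, by simp⟩)
    (fun x y hx hy f hf => by
      obtain ⟨f1, hf1, e1⟩ := hy f hf
      obtain ⟨f2, hf2, e2⟩ := hx f1 hf1
      exact ⟨f2, hf2, by rw [Matrix.mul_assoc, e1, ← Matrix.mul_assoc, e2, Matrix.mul_assoc]⟩)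
    (l := fgens) (fun g hg u hu => U_step hu hg) w
  exact this u hu

theorem S_U {s u : M5} (hs : s ∈ Sl) (hu : u ∈ Ul) :
    ∃ w, ∃ s' ∈ Sl, ∃ f ∈ Fl,
      s.toMat * u.toMat = (word gensl w).toMat * (s'.toMat * f.toMat) := by
  obtain ⟨row, hrow⟩ := zipAll_spec _ _ _ certs_check s hs
  obtain ⟨c, hc⟩ := zipAll_spec _ _ _ hrow u hu
  refine ⟨c.1, _, getD_mem one_mem_Sl c.2.1, _, getD_mem one_mem_Fl c.2.2, ?_⟩
  rw [← toMat_mul, ← toMat_mul, ← toMat_mul, eq_of_eqb hc]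

theorem toMat_inj {x y : M5} (h : x.toMat = y.toMat) : x = y := by
  have h' : ∀ i j, x.toMat i j = y.toMat i j := fun i j => by rw [h]
  cases x; cases y
  rw [M5.mk.injEq]
  exact ⟨h' 0 0, h' 0 1, h' 0 2, h' 0 3, h' 0 4, h' 1 0, h' 1 1, h' 1 2, h' 1 3, h' 1 4,
    h' 2 0, h' 2 1, h' 2 2, h' 2 3, h' 2 4, h' 3 0, h' 3 1, h' 3 2, h' 3 3, h' 3 4,
    h' 4 0, h' 4 1, h' 4 2, h' 4 3, h' 4 4⟩

theorem genSet_cases {x : Mat} (hx : x ∈ genSet) :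
    (∃ g ∈ fgens, x = g.toMat) ∨ (∃ u ∈ Ul, x = u.toMat) := by
  have hU : ∀ u ∈ ugens, u ∈ Ul := by
    intro u hu
    have h := UU_check
    rw [List.all_eq_true] at h
    exact mem_of_mem (h u hu)
  simp only [genSet, Set.mem_insert_iff, Set.mem_singleton_iff] at hx
  rcases hx with rfl | rfl | rfl | rfl | rfl | rfl | rfl | rfl
  · exact Or.inl ⟨fgens.getD 0 one, by simp [fgens], by decide +kernel⟩
  · exact Or.inl ⟨fgens.getD 1 one, by simp [fgens], by decide +kernel⟩
  · exact Or.inl ⟨fgens.getD 2 one, by simp [fgens], by decide +kernel⟩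
  · exact Or.inl ⟨fgens.getD 3 one, by simp [fgens], by decide +kernel⟩
  · exact Or.inr ⟨ugens.getD 0 one, hU _ (by simp [ugens]), by decide +kernel⟩
  · exact Or.inr ⟨ugens.getD 1 one, hU _ (by simp [ugens]), by decide +kernel⟩
  · exact Or.inr ⟨ugens.getD 2 one, hU _ (by simp [ugens]), by decide +kernel⟩
  · exact Or.inr ⟨ugens.getD 3 one, hU _ (by simp [ugens]), by decide +kernel⟩

/-- Finitely many coset representatives suffice. -/
theorem K_cosets {p : Mat → Prop} (h1 : p 1) (hm : ∀ x y, p x → p y → p (x * y))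
    (h0 : ∀ m ∈ gens0, p m.toMat) {X : Mat} (hX : X ∈ K) :
    ∃ d, p d ∧ ∃ s ∈ Sl, ∃ f ∈ Fl, X = d * (s.toMat * f.toMat) := by
  have hgl := gensl_ind h1 hm h0
  induction hX using Submonoid.closure_induction_right with
  | one => exact ⟨1, h1, one, one_mem_Sl, one, one_mem_Fl, by simp [toMat_one]⟩
  | mul_right x hx y hy ih =>
    obtain ⟨d, hd, s, hs, f, hf, rfl⟩ := ih
    rcases genSet_cases hy with ⟨g, hg, rfl⟩ | ⟨u, hu, rfl⟩
    · refine ⟨d, hd, s, hs, mul f g, F_step hf hg, ?_⟩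
      rw [toMat_mul]; simp only [Matrix.mul_assoc]
    · obtain ⟨v, hv, e1⟩ := F_U hf hu
      obtain ⟨w, s', hs', f', hf', e2⟩ := S_U hs hv
      obtain ⟨f'', hf'', e3⟩ := F_mul hf' hf
      refine ⟨d * (word gensl w).toMat, hm _ _ hd (word_ind h1 hm hgl w), s', hs', f'', hf'', ?_⟩
      calc d * (s.toMat * f.toMat) * u.toMat = d * (s.toMat * (f.toMat * u.toMat)) := by
            simp only [Matrix.mul_assoc]
        _ = d * ((s.toMat * v.toMat) * f.toMat) := by rw [e1]; simp only [Matrix.mul_assoc]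
        _ = d * (word gensl w).toMat * (s'.toMat * (f'.toMat * f.toMat)) := by
            rw [e2]; simp only [Matrix.mul_assoc]
        _ = _ := by rw [e3]

def P : Mat := !![-2, 0, -1, -1, 0; 0, -1, -2, 2, 4; 1, -2, -2, 1, 4; 2, -2, -1, 0, 4;
  -1, -1, 0, -2, 0]
def Nm : Mat := !![3, 1, -2, -3, 1; 0, -2, 1, 3, 7; -3, 1, 1, -3, -11; 3, 1, -2, 0, 7;
  -3, -2, 1, 3, 1]
def K12 : Mat := !![4, -8, 4, 4, -8; 12, 0, -12, 12, -12; -12, 12, -12, 0, 12; -8, 4, 4, -8, 4;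
  1, 7, -11, 7, 1]
def Ym : Mat := !![0, 0, 0, 0, 4; 0, 0, 0, 0, 0; 0, 0, 0, 0, 0; 0, 0, 0, 0, 4; 0, 0, 0, 0, 1]
def Zm : Mat := !![24, -19, 0, 18, -25; 1, 0, -1, 1, -1; -1, 1, -1, 0, 1; 23, -18, 0, 17, -24;
  6, -4, -1, 5, -6]

theorem QP : matQ * P = (12 : ℤ) • Nm := by decide +kernel
theorem PK : P * K12 = (12 : ℤ) • (1 : Mat) := by decide +kernel
theorem KYZ : K12 = Ym * matQ + (12 : ℤ) • Zm := by decide +kernel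
theorem PQP : Pᵀ * matQ * P = (36 : ℤ) • J := by decide +kernel

theorem smul_cancel {n : ℤ} (hn : n ≠ 0) {x y : Mat} (h : n • x = n • y) : x = y := by
  ext i j
  have := congrFun (congrFun h i) j
  simp only [Matrix.smul_apply, smul_eq_mul] at this
  exact mul_left_cancel₀ hn this

theorem P_cancel {x y : Mat} (h : x * P = y * P) : x = y := by
  have h' : x * P * K12 = y * P * K12 := by rw [h]
  rw [Matrix.mul_assoc, Matrix.mul_assoc, PK] at h'
  rw [Matrix.mul_smul, Matrix.mul_smul, Matrix.mul_one, Matrix.mul_one] at h'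
  exact smul_cancel (n := 12) (by norm_num) h'

/-- An isometry of `matQ` preserves the sublattice spanned by the columns of `P`. -/
theorem bridge {g gi : Mat} (hg : gᵀ * matQ * g = matQ) (hgi : g * gi = 1) :
    ∃ h : Mat, P * h = g * P ∧ hᵀ * J * h = J := by
  have e1 : giᵀ * matQ = matQ * g := by
    calc giᵀ * matQ = giᵀ * (gᵀ * matQ * g) := by rw [hg]
      _ = (g * gi)ᵀ * matQ * g := by simp only [Matrix.transpose_mul, Matrix.mul_assoc]
      _ = matQ * g := by rw [hgi]; simp
  have e2 : (12 : ℤ) • (Ym * giᵀ * Nm + Zm * g * P) = K12 * g * P := by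
    calc (12 : ℤ) • (Ym * giᵀ * Nm + Zm * g * P)
        = Ym * giᵀ * ((12 : ℤ) • Nm) + ((12 : ℤ) • Zm) * g * P := by
          rw [smul_add, Matrix.mul_smul, Matrix.smul_mul, Matrix.smul_mul]
      _ = Ym * (giᵀ * matQ) * P + ((12 : ℤ) • Zm) * g * P := by
          rw [← QP]; simp only [Matrix.mul_assoc]
      _ = K12 * g * P := by
          rw [e1, KYZ]; simp only [Matrix.add_mul, Matrix.mul_assoc]
  have e3 : P * (Ym * giᵀ * Nm + Zm * g * P) = g * P := by
    apply smul_cancel (n := 12) (by norm_num)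
    rw [← Matrix.mul_smul, e2]
    calc P * (K12 * g * P) = (P * K12) * (g * P) := by simp only [Matrix.mul_assoc]
      _ = (12 : ℤ) • (g * P) := by rw [PK, Matrix.smul_mul, Matrix.one_mul]
  refine ⟨_, e3, ?_⟩
  generalize Ym * giᵀ * Nm + Zm * g * P = h at e3
  apply smul_cancel (n := 36) (by norm_num)
  calc (36 : ℤ) • (hᵀ * J * h) = hᵀ * ((36 : ℤ) • J) * h := by
        rw [Matrix.mul_smul, Matrix.smul_mul]
    _ = (P * h)ᵀ * matQ * (P * h) := by
        rw [← PQP]; simp only [Matrix.transpose_mul, Matrix.mul_assoc]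
    _ = Pᵀ * (gᵀ * matQ * g) * P := by
        rw [e3]; simp only [Matrix.transpose_mul, Matrix.mul_assoc]
    _ = (36 : ℤ) • J := by rw [hg, PQP]

/-- Matrices, in the basis `P`, of elements of a subgroup `G`. -/
def inD (G : Subgroup (GL (Fin 5) ℤ)) (m : Mat) : Prop :=
  ∃ δ ∈ G, (δ : Mat) * P = P * m

theorem inD_one (G : Subgroup (GL (Fin 5) ℤ)) : inD G 1 := ⟨1, G.one_mem, by simp⟩

theorem inD_mul (G : Subgroup (GL (Fin 5) ℤ)) (x y : Mat) (hx : inD G x) (hy : inD G y) :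
    inD G (x * y) := by
  obtain ⟨a, ha, ea⟩ := hx
  obtain ⟨b, hb, eb⟩ := hy
  refine ⟨a * b, G.mul_mem ha hb, ?_⟩
  rw [Units.val_mul, Matrix.mul_assoc, eb, ← Matrix.mul_assoc, ea, Matrix.mul_assoc]

theorem inD_inv (G : Subgroup (GL (Fin 5) ℤ)) {x y : Mat} (hx : inD G x) (h : x * y = 1) :
    inD G y := by
  obtain ⟨a, ha, ea⟩ := hx
  refine ⟨a⁻¹, G.inv_mem ha, ?_⟩
  calc ((a⁻¹ : GL (Fin 5) ℤ) : Mat) * P = ((a⁻¹ : GL (Fin 5) ℤ) : Mat) * (P * (x * y)) := by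
        rw [h, Matrix.mul_one]
    _ = ((a⁻¹ : GL (Fin 5) ℤ) : Mat) * (a : Mat) * (P * y) := by
        rw [← Matrix.mul_assoc P, ← ea]; simp only [Matrix.mul_assoc]
    _ = P * y := by rw [Units.inv_mul, Matrix.one_mul]

theorem gens0_inD {A B : GL (Fin 5) ℤ} (hA : (A : Mat) = matA) (hB : (B : Mat) = matB) :
    ∀ m ∈ gens0, inD (Subgroup.closure {A, B}) m.toMat := by
  have a0 : inD (Subgroup.closure {A, B}) (gens0.getD 0 one).toMat :=
    ⟨A, Subgroup.subset_closure (by simp), by rw [hA]; decide +kernel⟩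
  have b0 : inD (Subgroup.closure {A, B}) (gens0.getD 2 one).toMat :=
    ⟨B, Subgroup.subset_closure (by simp), by rw [hB]; decide +kernel⟩
  have a1 : inD (Subgroup.closure {A, B}) (gens0.getD 1 one).toMat :=
    inD_inv _ a0 (by decide +kernel)
  have b1 : inD (Subgroup.closure {A, B}) (gens0.getD 3 one).toMat :=
    inD_inv _ b0 (by decide +kernel)
  intro m hm
  simp only [gens0, List.mem_cons, List.not_mem_nil, or_false] at hm
  rcases hm with rfl | rfl | rfl | rfl
  · exact a0
  · exact a1
  · exact b0
  · exact b1

theorem exists_rep {A B : GL (Fin 5) ℤ} (hA : (A : Mat) = matA) (hB : (B : Mat) = matB)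
    (g : GL (Fin 5) ℤ) (hg : g ∈ orthogonalSubgroup matQ) :
    ∃ c : {s // s ∈ Sl} × {f // f ∈ Fl}, ∃ δ ∈ Subgroup.closure {A, B},
      (g : Mat) * P = (δ : Mat) * (P * (c.1.1.toMat * c.2.1.toMat)) := by
  obtain ⟨h, h1, h2⟩ := bridge (g := (g : Mat)) (gi := ((g⁻¹ : GL (Fin 5) ℤ) : Mat)) hg
    (Units.mul_inv g)
  obtain ⟨d, ⟨δ, hδ, e⟩, s, hs, f, hf, e'⟩ :=
    K_cosets (inD_one _) (inD_mul _) (gens0_inD hA hB) (iso_mem_K h h2)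
  refine ⟨(⟨s, hs⟩, ⟨f, hf⟩), δ, hδ, ?_⟩
  rw [← h1, e', ← Matrix.mul_assoc, ← e, Matrix.mul_assoc]

theorem finite_index {A B : GL (Fin 5) ℤ} (hA : (A : Mat) = matA) (hB : (B : Mat) = matB) :
    ((Subgroup.closure {A, B}).subgroupOf (orthogonalSubgroup matQ)).FiniteIndex := by
  set H := (Subgroup.closure {A, B}).subgroupOf (orthogonalSubgroup matQ) with hH
  have hex : ∀ g : orthogonalSubgroup matQ, ∃ c : {s // s ∈ Sl} × {f // f ∈ Fl},
      ∃ δ ∈ Subgroup.closure {A, B},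
      (((g : GL (Fin 5) ℤ)⁻¹ : GL (Fin 5) ℤ) : Mat) * P =
        (δ : Mat) * (P * (c.1.1.toMat * c.2.1.toMat)) := fun g =>
    exists_rep hA hB _ ((orthogonalSubgroup matQ).inv_mem g.2)
  choose φ hφ using hex
  have hfin : Finite ({s // s ∈ Sl} × {f // f ∈ Fl}) := by
    have : Finite {s // s ∈ Sl} := (List.finite_toSet Sl).to_subtype
    have : Finite {f // f ∈ Fl} := (List.finite_toSet Fl).to_subtype
    infer_instance
  have hinj : Function.Injective fun q : orthogonalSubgroup matQ ⧸ H => φ q.out := by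
    intro q q' hq
    simp only at hq
    obtain ⟨δ, hδ, e⟩ := hφ q.out
    obtain ⟨δ', hδ', e'⟩ := hφ q'.out
    rw [hq] at e
    have k : ∀ (x γ : GL (Fin 5) ℤ) (M : Mat), (x : Mat) * P = (γ : Mat) * M →
        ((γ⁻¹ * x : GL (Fin 5) ℤ) : Mat) * P = M := by
      intro x γ M hx
      rw [Units.val_mul, Matrix.mul_assoc, hx, ← Matrix.mul_assoc, Units.inv_mul, Matrix.one_mul]
    have h1 := k _ _ _ e
    have h2 := k _ _ _ e'
    have h3 := Units.ext (P_cancel (h1.trans h2.symm))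
    rw [← QuotientGroup.out_eq' q, ← QuotientGroup.out_eq' q', QuotientGroup.eq]
    refine Subgroup.mem_subgroupOf.2 ?_
    have h4 : ((q.out⁻¹ * q'.out : orthogonalSubgroup matQ) : GL (Fin 5) ℤ) = δ * δ'⁻¹ := by
      rw [Subgroup.coe_mul, Subgroup.coe_inv]
      calc (q.out : GL (Fin 5) ℤ)⁻¹ * (q'.out : GL (Fin 5) ℤ)
          = δ * (δ⁻¹ * (q.out : GL (Fin 5) ℤ)⁻¹) * (q'.out : GL (Fin 5) ℤ) := by group
        _ = δ * δ'⁻¹ := by rw [h3]; group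
    rw [h4]
    exact Subgroup.mul_mem _ hδ (Subgroup.inv_mem _ hδ')
  have : Finite (orthogonalSubgroup matQ ⧸ H) := Finite.of_injective _ hinj
  exact Subgroup.finiteIndex_of_finite_quotient

end HG

/-- Case 18 of Theorem 1.2: the hypergeometric group `Γ(f,g)` generated by the companion matrices `A`, `B`
of `f(x) = x^5 - x^4 + x - 1` and `g(x) = x^5 + 3*x^4 + 5*x^3 + 5*x^2 + 3*x + 1`
is an arithmetic subgroup of `O_Q(ℤ)`: it preserves `Q`, it is contained in `O_Q(ℤ)`,
and it has finite index in `O_Q(ℤ)`. -/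
theorem hypergeometric_group_arithmetic
    (A B : GL (Fin 5) ℤ)
    (hA : (A : Matrix (Fin 5) (Fin 5) ℤ) = matA)
    (hB : (B : Matrix (Fin 5) (Fin 5) ℤ) = matB) :
    matAᵀ * matQ * matA = matQ ∧
    matBᵀ * matQ * matB = matQ ∧
    Subgroup.closure {A, B} ≤ orthogonalSubgroup matQ ∧
    ((Subgroup.closure {A, B}).subgroupOf (orthogonalSubgroup matQ)).FiniteIndex := by
  have eA : matAᵀ * matQ * matA = matQ := by decide +kernel
  have eB : matBᵀ * matQ * matB = matQ := by decide +kernel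
  refine ⟨eA, eB, ?_, HG.finite_index hA hB⟩
  rw [Subgroup.closure_le]
  rintro x (rfl | rfl)
  · change (x : Matrix (Fin 5) (Fin 5) ℤ)ᵀ * matQ * (x : Matrix (Fin 5) (Fin 5) ℤ) = matQ
    rw [hA]; exact eA
  · change (x : Matrix (Fin 5) (Fin 5) ℤ)ᵀ * matQ * (x : Matrix (Fin 5) (Fin 5) ℤ) = matQ
    rw [hB]; exact eB
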